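/- arXiv:math/0601463 — 2 statements merged into one kernel-verified Lean document; each statement's English description precedes it below -/
import Mathlib

section
/- For integers k ≥ i ≥ 1 and complex q with 0 < |q| < 1, Σ_{n,j≥0} Ē_{k,i}(n,j) q^n = ((−q;q)_∞/(q;q)_∞) · Σ_{j=0}^{2(k−i)} (−1)^j (q^{i+j}, q^{2k−i−j}, q^{2k}; q^{2k})_∞. -/
namespace Paper

/-- The four kinds of unitary steps. -/
inductive PStep : Type
  | NE | SE | S | E
  deriving DecidableEq, BEq, Repr

/-- Horizontal displacement of a step. -/
def stepDx : PStep → ℕ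
  | .S => 0
  | _ => 1

/-- Vertical displacement of a step. -/
def stepDy : PStep → ℤ
  | .NE => 1
  | .SE => -1
  | .S => -1
  | .E => 0

/-- Height (`y`-coordinate) after performing the steps of `l`, starting at height `h`. -/
def pathHeight (h : ℕ) (l : List PStep) : ℤ := (h : ℤ) + (l.map stepDy).sum

/-- `x`-coordinate after performing the steps of `l`, starting on the `y`-axis. -/
def pathX (l : List PStep) : ℕ := (l.map stepDx).sum

/-- A valid path: stays in the first quadrant, starts at `(0,h)` on the `y`-axis, ends
on the `x`-axis, South steps only appear directly after a North-East step, East steps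
only appear at height `0`, and the path is empty or ends with a South-East or South step. -/
def ValidPath (h : ℕ) (l : List PStep) : Prop :=
  (∀ m : ℕ, 0 ≤ pathHeight h (l.take m)) ∧
  (∀ m : ℕ, l[m]? = some PStep.S → ∃ m', m = m' + 1 ∧ l[m']? = some PStep.NE) ∧
  (∀ m : ℕ, l[m]? = some PStep.E → pathHeight h (l.take m) = 0) ∧
  pathHeight h l = 0 ∧
  (l = [] ∨ l.getLast? = some PStep.SE ∨ l.getLast? = some PStep.S)

/-- The vertex reached after step `m` is a peak: it is preceded by a North-East step and
followed by a South-East step (NESE peak) or a South step (NES peak). -/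
def IsPeak (l : List PStep) (m : ℕ) : Prop :=
  l[m]? = some PStep.NE ∧ (l[m+1]? = some PStep.SE ∨ l[m+1]? = some PStep.S)

instance (l : List PStep) (m : ℕ) : Decidable (IsPeak l m) := by
  unfold IsPeak; infer_instance

/-- The major index of a path: the sum of the `x`-coordinates of its peaks. -/
def majorIndex (l : List PStep) : ℕ :=
  ∑ m ∈ Finset.range l.length, if IsPeak l m then pathX (l.take (m + 1)) else 0

/-- The number of peaks of a path. -/
def numPeaks (l : List PStep) : ℕ :=
  ((Finset.range l.length).filter fun m => IsPeak l m).card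

/-- The number of South steps of a path. -/
def southSteps (l : List PStep) : ℕ := l.count PStep.S

/-- A path satisfies the special `(k,i)`-conditions if it is a valid path starting at
height `k - i` whose height always stays below `k`. -/
def SpecialPath (k i : ℕ) (l : List PStep) : Prop :=
  ValidPath (k - i) l ∧ ∀ m : ℕ, pathHeight (k - i) (l.take m) < k

/-- `Ebar k i n j` is the number of paths with major index `n` and `j` South steps
satisfying the special `(k,i)`-conditions. -/
noncomputable def Ebar (k i n j : ℕ) : ℕ :=
  Nat.card {l : List PStep // SpecialPath k i l ∧ majorIndex l = n ∧ southSteps l = j}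


open scoped Classical

/-- The infinite q-Pochhammer symbol `(x;q)_∞ = ∏_{i≥0} (1 - x qⁱ)`. -/
noncomputable def qPochInf (x q : ℂ) : ℂ := ∏' i : ℕ, (1 - x * q ^ i)

/-- The finite q-Pochhammer symbol `(x;q)_N = ∏_{i=0}^{N-1} (1 - x qⁱ)`. -/
noncomputable def qPochN (x q : ℂ) (N : ℕ) : ℂ := ∏ i ∈ Finset.range N, (1 - x * q ^ i)

/-- The q-Pochhammer symbol with arbitrary integer index,
`(x;q)_n = (x;q)_∞ / (x qⁿ;q)_∞`. -/
noncomputable def qPochZ (x q : ℂ) (n : ℤ) : ℂ := qPochInf x q / qPochInf (x * q ^ n) q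


open Filter Topology

/-! ### Infinite products -/

lemma summable_norm_mul_pow (x : ℂ) {q : ℂ} (hq : ‖q‖ < 1) :
    Summable fun i : ℕ => ‖-(x * q ^ i)‖ := by
  simpa using (summable_geometric_of_lt_one (norm_nonneg q) hq).mul_left ‖x‖

lemma multipliable_one_sub_mul_pow (x : ℂ) {q : ℂ} (hq : ‖q‖ < 1) :
    Multipliable fun i : ℕ => 1 - x * q ^ i := by
  simpa [sub_eq_add_neg] using multipliable_one_add_of_summable (summable_norm_mul_pow x hq)

lemma tendsto_qPochN (x : ℂ) {q : ℂ} (hq : ‖q‖ < 1) :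
    Tendsto (qPochN x q) atTop (𝓝 (qPochInf x q)) :=
  (multipliable_one_sub_mul_pow x hq).hasProd.tendsto_prod_nat

lemma one_sub_mul_pow_ne_zero {x q : ℂ} (hx : ‖x‖ < 1) (hq : ‖q‖ < 1) (i : ℕ) :
    1 - x * q ^ i ≠ 0 := by
  intro h
  have h1 : ‖x * q ^ i‖ = 1 := by rw [← sub_eq_zero.mp h, norm_one]
  rw [norm_mul, norm_pow] at h1
  have h2 : ‖q‖ ^ i ≤ 1 := pow_le_one₀ (norm_nonneg q) hq.le
  nlinarith [norm_nonneg x, norm_nonneg q]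

lemma qPochInf_ne_zero {x q : ℂ} (hx : ‖x‖ < 1) (hq : ‖q‖ < 1) : qPochInf x q ≠ 0 := by
  have h := tprod_one_add_ne_zero_of_summable (f := fun i : ℕ => -(x * q ^ i))
    (fun i => by simpa [sub_eq_add_neg] using one_sub_mul_pow_ne_zero hx hq i)
    (summable_norm_mul_pow x hq)
  simpa [qPochInf, sub_eq_add_neg] using h

lemma qPochN_succ (x q : ℂ) (N : ℕ) : qPochN x q (N + 1) = qPochN x q N * (1 - x * q ^ N) :=
  Finset.prod_range_succ _ _

lemma norm_sq_lt_one {q : ℂ} (hq : ‖q‖ < 1) : ‖q ^ 2‖ < 1 := by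
  rw [norm_pow]; exact pow_lt_one₀ (norm_nonneg q) hq two_ne_zero

lemma qPochInf_mul_qPochInf_sq {q : ℂ} (hq : ‖q‖ < 1) :
    qPochInf q (q ^ 2) * qPochInf (q ^ 2) (q ^ 2) = qPochInf q q := by
  have he := multipliable_one_sub_mul_pow q (norm_sq_lt_one hq)
  have ho := multipliable_one_sub_mul_pow (q ^ 2) (norm_sq_lt_one hq)
  have := tprod_even_mul_odd (f := fun i : ℕ => 1 - q * q ^ i)
    (he.congr fun i => by rw [pow_mul]) (ho.congr fun i => by ring)
  rw [qPochInf, qPochInf, qPochInf, ← this]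
  congr 1 <;> refine tprod_congr fun i => by ring

lemma qPochInf_neg_mul_qPochInf {q : ℂ} (hq : ‖q‖ < 1) :
    qPochInf (-q) q * qPochInf q q = qPochInf (q ^ 2) (q ^ 2) := by
  rw [qPochInf, qPochInf, qPochInf, ← (multipliable_one_sub_mul_pow _ hq).tprod_mul
    (multipliable_one_sub_mul_pow _ hq)]
  refine tprod_congr fun i => by ring

/-- Euler's identity `(-q;q)_∞ (q;q²)_∞ = 1`. -/
lemma qPochInf_neg_mul_qPochInf_odd {q : ℂ} (hq : ‖q‖ < 1) :
    qPochInf (-q) q * qPochInf q (q ^ 2) = 1 := by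
  have h1 := qPochInf_mul_qPochInf_sq hq
  have h2 := qPochInf_neg_mul_qPochInf hq
  have h3 := qPochInf_ne_zero (norm_sq_lt_one hq) (norm_sq_lt_one hq)
  apply mul_right_cancel₀ h3
  rw [mul_assoc, h1, h2, one_mul]

/-! ### Reciprocals of `(q;q)_M` for integer `M` -/

/-- The reciprocal `1/(q;q)_M`, with the usual convention that it vanishes for `M < 0`. -/
noncomputable def invPoch (q : ℂ) (M : ℤ) : ℂ := if M < 0 then 0 else (qPochN q q M.toNat)⁻¹

lemma invPoch_of_neg (q : ℂ) {M : ℤ} (h : M < 0) : invPoch q M = 0 := if_pos h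

lemma invPoch_natCast (q : ℂ) (M : ℕ) : invPoch q M = (qPochN q q M)⁻¹ := by
  simp [invPoch]

lemma invPoch_mul_one_sub {q : ℂ} (hq : ‖q‖ < 1) (M : ℤ) :
    invPoch q M * (1 - q ^ M) = invPoch q (M - 1) := by
  rcases lt_trichotomy M 0 with h | rfl | h
  · rw [invPoch_of_neg q h, invPoch_of_neg q (by lia), zero_mul]
  · rw [invPoch_of_neg q (M := 0 - 1) (by lia), zpow_zero, sub_self, mul_zero]
  · obtain ⟨m, rfl⟩ : ∃ m : ℕ, M = (m + 1 : ℕ) := ⟨(M - 1).toNat, by lia⟩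
    rw [show ((m + 1 : ℕ) : ℤ) - 1 = (m : ℕ) by lia, invPoch_natCast, invPoch_natCast, qPochN_succ,
      zpow_natCast, pow_succ']
    have := one_sub_mul_pow_ne_zero hq hq m
    field_simp

lemma tendsto_invPoch {q : ℂ} (hq : ‖q‖ < 1) (n : ℤ) :
    Tendsto (fun N : ℕ => invPoch q (N + n)) atTop (𝓝 (qPochInf q q)⁻¹) := by
  have h := ((tendsto_qPochN q hq).inv₀ (qPochInf_ne_zero hq hq)).comp
    (tendsto_atTop_atTop.mpr fun b => ⟨b + n.natAbs, fun a ha => by lia⟩ :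
      Tendsto (fun N : ℕ => ((N : ℤ) + n).toNat) atTop atTop)
  refine h.congr' ?_
  filter_upwards [eventually_ge_atTop n.natAbs] with N hN
  simp [invPoch, show ¬ ((N : ℤ) + n < 0) by lia]

lemma exists_norm_invPoch_le {q : ℂ} (hq : ‖q‖ < 1) :
    ∃ C : ℝ, 0 ≤ C ∧ ∀ M : ℤ, ‖invPoch q M‖ ≤ C := by
  obtain ⟨C, hC⟩ := (Metric.isBounded_range_of_tendsto _ (tendsto_invPoch hq 0)).exists_norm_le
  have hC0 : 0 ≤ C := (norm_nonneg _).trans (hC _ ⟨0, rfl⟩)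
  refine ⟨C, hC0, fun M => ?_⟩
  rcases lt_or_ge M 0 with h | h
  · rwa [invPoch_of_neg q h, norm_zero]
  · exact hC _ ⟨M.toNat, by simp [h]⟩

lemma summable_mul_invPoch (q : ℂ) (d : ℤ → ℂ) (a b : ℤ) :
    Summable fun n : ℤ => d n * (invPoch q (a - n) * invPoch q (b + n)) := by
  refine summable_of_ne_finset_zero (s := Finset.Icc (-b) a) fun n hn => ?_
  rw [Finset.mem_Icc, not_and_or, not_le, not_le] at hn
  rcases hn with h | h
  · rw [invPoch_of_neg q (by lia : b + n < 0), mul_zero, mul_zero]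
  · rw [invPoch_of_neg q (by lia : a - n < 0), zero_mul, mul_zero]

/-- The transform `N ↦ Σ_n d_n / ((q;q)_{N-n} (q;q)_{N+n})` of a bilateral sequence `d`. -/
noncomputable def baileySum (q : ℂ) (d : ℤ → ℂ) (N : ℕ) : ℂ :=
  ∑' n : ℤ, d n * (invPoch q (N - n) * invPoch q (N + n))

/-! ### Triangular exponents -/

/-- The triangular exponent `n(n-1)/2`. -/
def tri (n : ℤ) : ℤ := n * (n - 1) / 2

lemma two_mul_tri (n : ℤ) : 2 * tri n = n * (n - 1) :=
  Int.mul_ediv_cancel' (Int.even_mul_pred_self n).two_dvd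

lemma tri_add_one (n : ℤ) : tri (n + 1) = tri n + n := by
  linarith [two_mul_tri n, two_mul_tri (n + 1)]

lemma tri_neg (n : ℤ) : tri (-n) = tri n + n := by
  linarith [two_mul_tri n, two_mul_tri (-n)]

lemma tri_nonneg (n : ℤ) : 0 ≤ tri n := by
  have := two_mul_tri n
  rcases le_or_gt n 0 with h | h <;> nlinarith

/-! ### The Jacobi triple product -/

/-- The summand `(-1)ⁿ zⁿ q^{n(n-1)/2}` of the theta series. -/
noncomputable def thetaTerm (z q : ℂ) (n : ℤ) : ℂ := (-1) ^ n * z ^ n * q ^ tri n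

lemma thetaTerm_add_one {z q : ℂ} (hz : z ≠ 0) (hq : q ≠ 0) (n : ℤ) :
    thetaTerm z q (n + 1) = -(z * q ^ n * thetaTerm z q n) := by
  rw [thetaTerm, thetaTerm, tri_add_one, zpow_add₀ hq, zpow_add_one₀ hz,
    zpow_add_one₀ (neg_ne_zero.mpr one_ne_zero)]
  ring

lemma baileySum_thetaTerm_succ {z q : ℂ} (hz : z ≠ 0) (hq0 : q ≠ 0) (hq : ‖q‖ < 1) (N : ℕ) :
    baileySum q (thetaTerm z q) (N + 1) * ((1 - q ^ (2 * N + 1)) * (1 - q ^ (2 * N + 2))) =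
      (1 - z * q ^ N) * (1 - q / z * q ^ N) * baileySum q (thetaTerm z q) N := by
  set d := thetaTerm z q with hd
  have hdz : ∀ n, z * d n = -(d (n + 1) * q ^ (-n)) := fun n => by
    rw [hd, thetaTerm_add_one hz hq0, zpow_neg]
    field_simp
  have hdz' : ∀ n, d n * z⁻¹ = -(d (n - 1) * q ^ (n - 1)) := fun n => by
    obtain ⟨m, rfl⟩ : ∃ m, n = m + 1 := ⟨n - 1, by ring⟩
    rw [hd, thetaTerm_add_one hz hq0, add_sub_cancel_right]
    field_simp
  have h1 : z * baileySum q d N =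
      ∑' n : ℤ, -(d n * q ^ (1 - n)) * (invPoch q (N + 1 - n) * invPoch q (N - 1 + n)) := by
    rw [baileySum, ← tsum_mul_left, ← (Equiv.addRight (1 : ℤ)).tsum_eq (fun n : ℤ =>
      -(d n * q ^ (1 - n)) * (invPoch q (N + 1 - n) * invPoch q (N - 1 + n)))]
    refine tsum_congr fun n => ?_
    rw [Equiv.coe_addRight, ← mul_assoc, hdz]
    ring_nf
  have h2 : z⁻¹ * baileySum q d N =
      ∑' n : ℤ, -(d n * q ^ n) * (invPoch q (N - 1 - n) * invPoch q (N + 1 + n)) := by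
    rw [baileySum, ← tsum_mul_left, ← (Equiv.addRight (-1 : ℤ)).tsum_eq (fun n : ℤ =>
      -(d n * q ^ n) * (invPoch q (N - 1 - n) * invPoch q (N + 1 + n)))]
    refine tsum_congr fun n => ?_
    rw [Equiv.coe_addRight, ← mul_assoc, mul_comm z⁻¹, hdz']
    ring_nf
  have h3 : (1 - z * q ^ N) * (1 - q / z * q ^ N) * baileySum q d N =
      (1 + q ^ (2 * N + 1)) * baileySum q d N - q ^ N * (z * baileySum q d N)
        - q ^ (N + 1) * (z⁻¹ * baileySum q d N) := by
    field_simp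
    ring
  rw [h3, h1, h2, baileySum, baileySum, ← tsum_mul_left, ← tsum_mul_left, ← tsum_mul_left,
    ← tsum_mul_right, ← ((summable_mul_invPoch q d N N).mul_left _).tsum_sub
      ((summable_mul_invPoch q _ (N + 1) (N - 1)).mul_left _), ← Summable.tsum_sub
      (((summable_mul_invPoch q d N N).mul_left _).sub
        ((summable_mul_invPoch q _ (N + 1) (N - 1)).mul_left _))
      ((summable_mul_invPoch q _ (N - 1) (N + 1)).mul_left _)]
  refine tsum_congr fun n => ?_
  have ea := invPoch_mul_one_sub hq (N + 1 - n)
  have ea' := invPoch_mul_one_sub hq (N - n)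
  have eb := invPoch_mul_one_sub hq (N + 1 + n)
  have eb' := invPoch_mul_one_sub hq (N + n)
  rw [show (N : ℤ) + 1 - n - 1 = N - n by ring] at ea
  rw [show (N : ℤ) + 1 + n - 1 = N + n by ring] at eb
  rw [show (N : ℤ) - n - 1 = N - 1 - n by ring, ← ea] at ea'
  rw [show (N : ℤ) + n - 1 = N - 1 + n by ring, ← eb] at eb'
  rw [← ea', ← eb', ← ea, ← eb]
  push_cast
  simp only [zpow_add₀ hq0, zpow_sub₀ hq0, zpow_one, zpow_natCast, pow_add, mul_comm 2 N, pow_mul]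
  have hN : q ^ N ≠ 0 := pow_ne_zero _ hq0
  have hn : q ^ n ≠ 0 := zpow_ne_zero _ hq0
  field_simp
  ring

lemma qPochN_mul_baileySum_thetaTerm {z q : ℂ} (hz : z ≠ 0) (hq0 : q ≠ 0) (hq : ‖q‖ < 1) (N : ℕ) :
    qPochN q q (2 * N) * baileySum q (thetaTerm z q) N = qPochN z q N * qPochN (q / z) q N := by
  induction N with
  | zero =>
    rw [baileySum, tsum_eq_single 0]
    · simp [qPochN, invPoch, thetaTerm, tri]
    · intro n hn
      rcases lt_or_gt_of_ne hn with h | h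
      · simp [invPoch_of_neg q h]
      · rw [invPoch_of_neg q (by lia : ((0 : ℕ) : ℤ) - n < 0), zero_mul, mul_zero]
  | succ N ih =>
    have h := baileySum_thetaTerm_succ hz hq0 hq N
    rw [show 2 * (N + 1) = 2 * N + 1 + 1 by ring, qPochN_succ, qPochN_succ, qPochN_succ,
      qPochN_succ]
    linear_combination (qPochN q q (2 * N)) * h + (1 - z * q ^ N) * (1 - q / z * q ^ N) * ih

lemma summable_norm_thetaTerm {z q : ℂ} (hq0 : q ≠ 0) (hqz : ‖q‖ < ‖z‖) (hz : ‖z‖ < 1) :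
    Summable fun n : ℤ => ‖thetaTerm z q n‖ := by
  have hq : ‖q‖ < 1 := hqz.trans hz
  have hqp : 0 < ‖q‖ := norm_pos_iff.mpr hq0
  have hzp : 0 < ‖z‖ := hqp.trans hqz
  apply Summable.of_nat_of_neg
  · refine Summable.of_nonneg_of_le (fun _ => norm_nonneg _) (fun n => ?_)
      (summable_geometric_of_lt_one (norm_nonneg z) hz)
    have : ‖q‖ ^ tri n ≤ 1 := zpow_le_one₀ hqp hq.le (tri_nonneg _)
    simpa [thetaTerm] using mul_le_mul_of_nonneg_left this (pow_nonneg hzp.le n)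
  · refine Summable.of_nonneg_of_le (fun _ => norm_nonneg _) (fun n => ?_)
      (summable_geometric_of_lt_one (div_nonneg hqp.le hzp.le) ((div_lt_one hzp).mpr hqz))
    have : ‖q‖ ^ tri n ≤ 1 := zpow_le_one₀ hqp hq.le (tri_nonneg _)
    have h := mul_le_mul_of_nonneg_left this (pow_nonneg (div_nonneg hqp.le hzp.le) n)
    rw [mul_one] at h
    refine le_of_eq_of_le ?_ h
    rw [thetaTerm, tri_neg, zpow_add₀ hq0]
    simp only [norm_mul, norm_zpow, norm_neg, norm_one, zpow_neg, zpow_natCast, norm_inv,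
      norm_pow, div_pow, inv_one, one_pow]
    field_simp

/-- The Jacobi triple product identity. -/
lemma tsum_thetaTerm {z q : ℂ} (hq0 : q ≠ 0) (hqz : ‖q‖ < ‖z‖) (hz : ‖z‖ < 1) :
    ∑' n : ℤ, thetaTerm z q n = qPochInf z q * qPochInf (q / z) q * qPochInf q q := by
  have hq : ‖q‖ < 1 := hqz.trans hz
  have hz0 : z ≠ 0 := norm_pos_iff.mp ((norm_nonneg q).trans_lt hqz)
  have hne := qPochInf_ne_zero hq hq
  obtain ⟨C, hC0, hC⟩ := exists_norm_invPoch_le hq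
  have h1 : Tendsto (baileySum q (thetaTerm z q)) atTop
      (𝓝 (∑' n : ℤ, thetaTerm z q n * ((qPochInf q q)⁻¹ * (qPochInf q q)⁻¹))) := by
    refine tendsto_tsum_of_dominated_convergence
      ((summable_norm_thetaTerm hq0 hqz hz).mul_right (C * C)) (fun n => ?_)
      (Eventually.of_forall fun N n => ?_)
    · exact ((tendsto_invPoch hq (-n)).mul (tendsto_invPoch hq n)).const_mul _
    · rw [norm_mul, norm_mul]
      gcongr <;> apply hC
  have h2 := ((tendsto_qPochN q hq).comp
    (tendsto_id.const_mul_atTop' two_pos : Tendsto (fun N : ℕ => 2 * N) atTop atTop)).mul h1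
  have h3 := (tendsto_qPochN z hq).mul (tendsto_qPochN (q / z) hq)
  have h4 := tendsto_nhds_unique (h2.congr fun N => qPochN_mul_baileySum_thetaTerm hz0 hq0 hq N) h3
  rw [tsum_mul_right] at h4
  rw [← h4]
  field_simp

/-! ### The bilateral sequence attached to the path recurrences -/

/-- The coefficients `(-1)ⁿ q^{(k-1)n² - hn + n(n-1)/2}`. -/
noncomputable def pathCoeff (q : ℂ) (k h n : ℤ) : ℂ :=
  (-1) ^ n * q ^ ((k - 1) * n ^ 2 - h * n + tri n)

lemma pathCoeff_sub_one {q : ℂ} (hq0 : q ≠ 0) (k h n : ℤ) :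
    pathCoeff q k (h - 1) n = pathCoeff q k h n * q ^ n := by
  rw [pathCoeff, pathCoeff, mul_assoc, ← zpow_add₀ hq0]
  ring_nf

lemma pathCoeff_zero_neg (q : ℂ) (k n : ℤ) : pathCoeff q k 0 (-n) = pathCoeff q k (-1) n := by
  rw [pathCoeff, pathCoeff, tri_neg, zpow_neg, ← inv_zpow, inv_neg_one]
  ring_nf

lemma pathCoeff_one_sub (q : ℂ) (k n : ℤ) :
    pathCoeff q k (k - 1) (1 - n) = -pathCoeff q k (k - 1) n := by
  have h : tri (1 - n) = tri n := by linarith [two_mul_tri n, two_mul_tri (1 - n)]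
  rw [pathCoeff, pathCoeff, h, zpow_sub₀ (neg_ne_zero.mpr one_ne_zero), zpow_one, div_eq_mul_inv,
    ← inv_zpow, inv_neg_one]
  ring_nf

/-- The companion of `baileySum` with denominators `(q;q)_{N-n} (q;q)_{N+n-1}`. -/
noncomputable def baileySumAux (q : ℂ) (d : ℤ → ℂ) (N : ℕ) : ℂ :=
  ∑' n : ℤ, d n * (invPoch q (N - n) * invPoch q (N - 1 + n))

lemma baileySum_sub {q : ℂ} (hq0 : q ≠ 0) (hq : ‖q‖ < 1) (k h : ℤ) (N : ℕ) :
    baileySum q (pathCoeff q k h) N - q ^ N * baileySum q (pathCoeff q k (h - 1)) N =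
      baileySumAux q (pathCoeff q k h) N := by
  rw [baileySum, baileySum, baileySumAux, ← tsum_mul_left,
    ← (summable_mul_invPoch _ _ _ _).tsum_sub ((summable_mul_invPoch _ _ _ _).mul_left _)]
  refine tsum_congr fun n => ?_
  rw [pathCoeff_sub_one hq0, show (N : ℤ) - 1 + n = N + n - 1 by ring, ← invPoch_mul_one_sub hq,
    zpow_add₀ hq0, zpow_natCast]
  ring

lemma baileySumAux_sub {q : ℂ} (hq0 : q ≠ 0) (hq : ‖q‖ < 1) (k h : ℤ) (N : ℕ) :
    baileySumAux q (pathCoeff q k h) (N + 1) -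
        q ^ (N + 1) * baileySumAux q (pathCoeff q k (h + 1)) (N + 1) =
      baileySum q (pathCoeff q k h) N := by
  rw [baileySum, baileySumAux, baileySumAux, ← tsum_mul_left,
    ← (summable_mul_invPoch _ _ _ _).tsum_sub ((summable_mul_invPoch _ _ _ _).mul_left _)]
  refine tsum_congr fun n => ?_
  have h1 := pathCoeff_sub_one hq0 k (h + 1) n
  rw [add_sub_cancel_right] at h1
  have h2 := invPoch_mul_one_sub hq ((N : ℤ) + 1 - n)
  rw [show (N : ℤ) + 1 - n - 1 = N - n by ring, zpow_sub₀ hq0, ← Nat.cast_succ, zpow_natCast] at h2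
  rw [h1, ← h2]
  have hn : q ^ n ≠ 0 := zpow_ne_zero _ hq0
  simp only [Nat.cast_succ, add_sub_cancel_right, Nat.succ_eq_add_one]
  field_simp

lemma baileySum_neg_one (q : ℂ) (k : ℤ) (N : ℕ) :
    baileySum q (pathCoeff q k (-1)) N = baileySum q (pathCoeff q k 0) N := by
  rw [baileySum, baileySum, ← (Equiv.neg ℤ).tsum_eq (fun n : ℤ => pathCoeff q k 0 n * _)]
  refine tsum_congr fun n => ?_
  rw [Equiv.neg_apply, pathCoeff_zero_neg, sub_neg_eq_add, ← sub_eq_add_neg, mul_comm (invPoch q _)]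

lemma baileySumAux_top (q : ℂ) (k : ℤ) (N : ℕ) :
    baileySumAux q (pathCoeff q k (k - 1)) N = 0 := by
  have h : baileySumAux q (pathCoeff q k (k - 1)) N =
      -baileySumAux q (pathCoeff q k (k - 1)) N := by
    conv_lhs => rw [baileySumAux, ← (Equiv.subLeft (1 : ℤ)).tsum_eq]
    rw [baileySumAux, ← tsum_neg]
    refine tsum_congr fun n => ?_
    rw [Equiv.subLeft_apply, pathCoeff_one_sub, show (N : ℤ) - (1 - n) = N - 1 + n by ring,
      show (N : ℤ) - 1 + (1 - n) = N - n by ring]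
    ring
  exact self_eq_neg.mp h

lemma baileySum_zero (q : ℂ) (k h : ℤ) : baileySum q (pathCoeff q k h) 0 = 1 := by
  rw [baileySum, tsum_eq_single 0]
  · simp [qPochN, invPoch, pathCoeff, tri]
  · intro n hn
    rcases lt_or_gt_of_ne hn with h | h
    · simp [invPoch_of_neg q h]
    · rw [invPoch_of_neg q (by lia : ((0 : ℕ) : ℤ) - n < 0), zero_mul, mul_zero]

/-! ### A limiting case of the `q`-Gauss sum -/

/-- The weight `q^{N(N+1)/2} (-1;q)_N`. -/
noncomputable def peakWeight (q : ℂ) (N : ℕ) : ℂ := ∏ j ∈ Finset.range N, q ^ (j + 1) * (1 + q ^ j)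

lemma peakWeight_succ (q : ℂ) (N : ℕ) :
    peakWeight q (N + 1) = peakWeight q N * (q ^ (N + 1) * (1 + q ^ N)) :=
  Finset.prod_range_succ _ _

lemma exists_norm_peakWeight_le {q : ℂ} (hq : ‖q‖ < 1) :
    ∃ C : ℝ, 0 ≤ C ∧ ∀ N : ℕ, ‖peakWeight q N‖ ≤ C * ‖q‖ ^ N := by
  obtain ⟨C, hC⟩ := (Metric.isBounded_range_of_tendsto _ (tendsto_qPochN (-1) hq)).exists_norm_le
  have hC0 : 0 ≤ C := (norm_nonneg _).trans (hC _ ⟨0, rfl⟩)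
  refine ⟨C, hC0, fun N => ?_⟩
  have h1 : ‖∏ j ∈ Finset.range N, q ^ (j + 1)‖ ≤ ‖q‖ ^ N := by
    rw [norm_prod]
    refine (Finset.prod_le_prod (fun _ _ => norm_nonneg _) fun j _ => ?_).trans_eq
      (Finset.prod_const (s := Finset.range N) ‖q‖) |>.trans_eq (by rw [Finset.card_range])
    rw [norm_pow]
    exact pow_le_of_le_one (norm_nonneg q) hq.le j.succ_ne_zero
  have h2 : ‖∏ j ∈ Finset.range N, (1 + q ^ j)‖ ≤ C := by
    simpa [qPochN] using hC _ ⟨N, rfl⟩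
  rw [peakWeight, Finset.prod_mul_distrib, norm_mul, mul_comm]
  gcongr

lemma exists_norm_gaussTerm_le {q : ℂ} (hq : ‖q‖ < 1) :
    ∃ C : ℝ, 0 ≤ C ∧ ∀ (N : ℕ) (a b : ℤ),
      ‖peakWeight q N * (invPoch q a * invPoch q b)‖ ≤ C * ‖q‖ ^ N := by
  obtain ⟨A, hA0, hA⟩ := exists_norm_invPoch_le hq
  obtain ⟨B, hB0, hB⟩ := exists_norm_peakWeight_le hq
  refine ⟨B * (A * A), by positivity, fun N a b => ?_⟩
  rw [norm_mul, norm_mul, mul_right_comm]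
  gcongr
  exacts [hB N, hA a, hA b]

lemma summable_gaussTerm {q : ℂ} (hq : ‖q‖ < 1) (a b : ℕ → ℤ) :
    Summable fun N : ℕ => peakWeight q N * (invPoch q (a N) * invPoch q (b N)) := by
  obtain ⟨C, -, hC⟩ := exists_norm_gaussTerm_le hq
  exact Summable.of_norm_bounded
    ((summable_geometric_of_lt_one (norm_nonneg q) hq).mul_left C) fun N => hC N _ _

/-- The series `Σ_N q^{N(N+1)/2} (-1;q)_N / ((q;q)_{N-n} (q;q)_{N+n})`. -/
noncomputable def gaussSum (q : ℂ) (n : ℤ) : ℂ :=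
  ∑' N : ℕ, peakWeight q N * (invPoch q (N - n) * invPoch q (N + n))

lemma gaussSum_add_one {q : ℂ} (hq0 : q ≠ 0) (hq : ‖q‖ < 1) (n : ℤ) :
    gaussSum q (n + 1) * (1 + q ^ (n + 1)) = q ^ (n + 1) * (1 + q ^ n) * gaussSum q n := by
  set G : ℕ → ℂ := fun N =>
    peakWeight q N * (invPoch q (N - n - 1) * invPoch q (N + n)) * -(1 - q ^ (2 * n + 1)) with hG
  have hG0 : G 0 = 0 := by
    rcases lt_or_ge n 0 with h | h
    · simp [hG, invPoch_of_neg q h]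
    · simp [hG, invPoch_of_neg q (by lia : -n - 1 < 0)]
  have hGlim : Tendsto G atTop (𝓝 0) :=
    ((summable_gaussTerm hq _ _).mul_right _).tendsto_atTop_zero
  have h1 := summable_gaussTerm hq (fun N => N - (n + 1)) (fun N => N + (n + 1))
  have h2 := summable_gaussTerm hq (fun N => N - n) (fun N => N + n)
  have hterm : ∀ N : ℕ,
      peakWeight q N * (invPoch q (N - (n + 1)) * invPoch q (N + (n + 1))) * (1 + q ^ (n + 1)) -
        q ^ (n + 1) * (1 + q ^ n) * (peakWeight q N * (invPoch q (N - n) * invPoch q (N + n))) =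
      G (N + 1) - G N := fun N => by
    have e1 := invPoch_mul_one_sub hq (N - n)
    have e2 := invPoch_mul_one_sub hq (N + (n + 1))
    rw [show (N : ℤ) + (n + 1) - 1 = N + n by ring] at e2
    simp only [hG]
    rw [show ((N + 1 : ℕ) : ℤ) - n - 1 = N - n by push_cast; ring,
      show ((N + 1 : ℕ) : ℤ) + n = N + (n + 1) by push_cast; ring,
      show (N : ℤ) - (n + 1) = N - n - 1 by ring, ← e1, ← e2, peakWeight_succ]
    simp only [zpow_add₀ hq0, zpow_sub₀ hq0, zpow_one, zpow_natCast, pow_add, pow_one, mul_comm 2 n,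
      zpow_mul]
    have hn : q ^ n ≠ 0 := zpow_ne_zero _ hq0
    simp only [zpow_ofNat]
    field_simp
    ring
  have hs := (h1.mul_right (1 + q ^ (n + 1))).sub (h2.mul_left (q ^ (n + 1) * (1 + q ^ n)))
  have hlim : Tendsto (fun M => ∑ N ∈ Finset.range M, (G (N + 1) - G N)) atTop (𝓝 0) := by
    simpa only [Finset.sum_range_sub, hG0, sub_zero] using hGlim
  have hz := tendsto_nhds_unique hs.hasSum.tendsto_sum_nat
    (hlim.congr fun M => Finset.sum_congr rfl fun N _ => (hterm N).symm)
  rw [(h1.mul_right _).tsum_sub (h2.mul_left _), tsum_mul_right, tsum_mul_left] at hz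
  exact sub_eq_zero.mp hz

lemma one_add_zpow_ne_zero {q : ℂ} (hq : ‖q‖ < 1) (n : ℤ) : 1 + q ^ n ≠ 0 := by
  intro h
  have h1 : ‖q‖ ^ n = 1 := by rw [← norm_zpow, eq_neg_of_add_eq_zero_right h, norm_neg, norm_one]
  have h2 : n = 0 := by
    by_contra hn
    exact hn ((zpow_eq_one_iff_right₀ (norm_nonneg q) hq.ne).mp h1)
  subst h2
  norm_num at h

lemma gaussSum_mul_one_add {q : ℂ} (hq0 : q ≠ 0) (hq : ‖q‖ < 1) (n : ℤ) :
    gaussSum q n * (1 + q ^ n) = 2 * q ^ (tri n + n) * gaussSum q 0 := by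
  have step : ∀ m : ℤ, gaussSum q (m + 1) * (1 + q ^ (m + 1)) =
      q ^ (m + 1) * (gaussSum q m * (1 + q ^ m)) := fun m => by
    rw [gaussSum_add_one hq0 hq]; ring
  induction n with
  | zero => simp [tri]; ring
  | succ m ih =>
    rw [step, ih, tri_add_one, zpow_add₀ hq0 (tri m + m)]
    ring
  | pred m ih =>
    have h := step (-(m : ℤ) - 1)
    rw [sub_add_cancel, ih] at h
    have ht := tri_add_one (-(m : ℤ) - 1)
    rw [sub_add_cancel] at ht
    have hm : q ^ (-(m : ℤ)) ≠ 0 := zpow_ne_zero _ hq0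
    apply mul_left_cancel₀ hm
    rw [← h, ht, zpow_add₀ hq0 _ (-(m : ℤ))]
    ring

/-! ### Summation over the number of peaks -/

lemma summable_pathCoeff_mul_gaussTerm {q : ℂ} (hq0 : q ≠ 0) (hq : ‖q‖ < 1) {k h : ℤ} (h0 : 0 ≤ h)
    (hk : h + 1 ≤ k) :
    Summable fun p : ℕ × ℤ => pathCoeff q k h p.2 *
      (peakWeight q p.1 * (invPoch q (p.1 - p.2) * invPoch q (p.1 + p.2))) := by
  obtain ⟨C, hC0, hC⟩ := exists_norm_gaussTerm_le hq
  set s := √‖q‖ with hs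
  have hs0 : 0 ≤ s := Real.sqrt_nonneg _
  have hss : s ^ 2 = ‖q‖ := Real.sq_sqrt (norm_nonneg q)
  have hs1 : s < 1 := by nlinarith
  have hg := summable_geometric_of_lt_one hs0 hs1
  have hgz : Summable fun n : ℤ => s ^ n.natAbs :=
    Summable.of_nat_of_neg (by simpa using hg) (by simpa using hg)
  refine Summable.of_norm_bounded ((hg.mul_of_nonneg hgz (fun _ => by positivity)
    (fun _ => by positivity)).mul_left C) fun ⟨N, n⟩ => ?_
  rcases le_or_gt n.natAbs N with hn | hn
  · have hc : ‖pathCoeff q k h n‖ ≤ 1 := by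
      have he : 0 ≤ (k - 1) * n ^ 2 - h * n + tri n := by
        have := tri_nonneg n
        nlinarith [Int.le_self_sq n, mul_nonneg h0 (sub_nonneg.mpr (Int.le_self_sq n)),
          mul_nonneg (sub_nonneg.mpr hk) (sq_nonneg n)]
      simpa [pathCoeff] using zpow_le_one₀ (norm_pos_iff.mpr hq0) hq.le he
    calc _ ≤ 1 * (C * ‖q‖ ^ N) := by
          rw [norm_mul]
          exact mul_le_mul hc (hC _ _ _) (norm_nonneg _) zero_le_one
      _ = C * (s ^ N * s ^ N) := by rw [← hss]; ring
      _ ≤ C * (s ^ N * s ^ n.natAbs) := by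
          have hpow := pow_le_pow_of_le_one hs0 hs1.le hn
          exact mul_le_mul_of_nonneg_left (mul_le_mul_of_nonneg_left hpow (pow_nonneg hs0 N)) hC0
  · have : invPoch q (N - n) * invPoch q (N + n) = 0 := by
      rcases lt_or_ge n 0 with h | h
      · rw [invPoch_of_neg q (by lia : (N : ℤ) + n < 0), mul_zero]
      · rw [invPoch_of_neg q (by lia : (N : ℤ) - n < 0), zero_mul]
    simp only [this, mul_zero, norm_zero]
    positivity

lemma gaussSum_neg (q : ℂ) (n : ℤ) : gaussSum q (-n) = gaussSum q n := by
  refine tsum_congr fun N => ?_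
  rw [sub_neg_eq_add, ← sub_eq_add_neg, mul_comm (invPoch q _)]

lemma pathCoeff_mul_gaussSum_symm {q : ℂ} (hq0 : q ≠ 0) (hq : ‖q‖ < 1) {k h : ℕ} (hk : h < k)
    (n : ℤ) :
    pathCoeff q k h n * gaussSum q n + pathCoeff q k h (-n) * gaussSum q (-n) =
      2 * (gaussSum q 0 * ∑ j ∈ Finset.range (2 * h + 1),
        (-1) ^ j * thetaTerm (q ^ (k - h + j)) (q ^ (2 * k)) n) := by
  have hx := one_add_zpow_ne_zero hq n
  have hS := gaussSum_mul_one_add hq0 hq n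
  set x := q ^ n with hxdef
  have hgeom : (∑ j ∈ Finset.range (2 * h + 1), (-x) ^ j) * (1 + x) = 1 + x ^ (2 * h + 1) := by
    have := mul_neg_geom_sum (-x) (2 * h + 1)
    rw [Odd.neg_pow ⟨h, rfl⟩] at this
    linear_combination this
  have hterm : ∀ j : ℕ, (-1) ^ j * thetaTerm (q ^ (k - h + j)) (q ^ (2 * k)) n =
      (-1) ^ n * q ^ ((k : ℤ) * n ^ 2 - h * n) * (-x) ^ j := fun j => by
    have e : q ^ ((k : ℤ) * n ^ 2 - h * n) * x ^ j =
        (q ^ (k - h + j)) ^ n * (q ^ (2 * k)) ^ tri n := by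
      rw [hxdef, ← zpow_natCast, ← zpow_natCast, ← zpow_natCast, ← zpow_mul, ← zpow_mul, ← zpow_mul,
        ← zpow_add₀ hq0, ← zpow_add₀ hq0]
      congr 1
      push_cast [Nat.cast_sub hk.le]
      linear_combination -(k : ℤ) * two_mul_tri n
    rw [thetaTerm, neg_pow]
    linear_combination -((-1) ^ n * (-1) ^ j) * e
  rw [Finset.sum_congr rfl fun j _ => hterm j, ← Finset.mul_sum, gaussSum_neg]
  apply mul_right_cancel₀ hx
  have e1 : pathCoeff q k h n * q ^ (tri n + n) = (-1) ^ n * q ^ ((k : ℤ) * n ^ 2 - h * n) := by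
    rw [pathCoeff, mul_assoc, ← zpow_add₀ hq0]
    congr 2
    linear_combination two_mul_tri n
  have e2 : pathCoeff q k h (-n) * q ^ (tri n + n) =
      (-1) ^ n * q ^ ((k : ℤ) * n ^ 2 - h * n) * x ^ (2 * h + 1) := by
    rw [pathCoeff, mul_assoc, ← zpow_add₀ hq0, hxdef, ← zpow_natCast, ← zpow_mul, mul_assoc,
      ← zpow_add₀ hq0, zpow_neg, ← inv_zpow, inv_neg_one, tri_neg]
    congr 2
    push_cast
    linear_combination two_mul_tri n
  linear_combination (pathCoeff q k h n + pathCoeff q k h (-n)) * hS + 2 * gaussSum q 0 * (e1 + e2) -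
    2 * gaussSum q 0 * ((-1) ^ n * q ^ ((k : ℤ) * n ^ 2 - h * n)) * hgeom

/-- The alternating sum of theta products on the right-hand side. -/
noncomputable def thetaSum (q : ℂ) (k h : ℕ) : ℂ :=
  ∑ j ∈ Finset.range (2 * h + 1), (-1 : ℂ) ^ j *
    (qPochInf (q ^ (k - h + j)) (q ^ (2 * k)) * qPochInf (q ^ (k + h - j)) (q ^ (2 * k)) *
      qPochInf (q ^ (2 * k)) (q ^ (2 * k)))

lemma tsum_peakWeight_mul_baileySum_eq_gaussSum {q : ℂ} (hq0 : q ≠ 0) (hq : ‖q‖ < 1) {k h : ℕ}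
    (hk : h < k) :
    ∑' N : ℕ, peakWeight q N * baileySum q (pathCoeff q k h) N =
      gaussSum q 0 * thetaSum q k h := by
  have hsum := summable_pathCoeff_mul_gaussTerm hq0 hq (k := k) (h := h) (by lia) (by lia)
  have hr0 : 0 < ‖q‖ := norm_pos_iff.mpr hq0
  have hnorm : ∀ j ∈ Finset.range (2 * h + 1),
      ‖q ^ (2 * k)‖ < ‖q ^ (k - h + j)‖ ∧ ‖q ^ (k - h + j)‖ < 1 := fun j hj => by
    rw [Finset.mem_range] at hj
    rw [norm_pow, norm_pow]
    exact ⟨pow_lt_pow_right_of_lt_one₀ hr0 hq (by lia), pow_lt_one₀ hr0.le hq (by lia)⟩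
  have hqk : q ^ (2 * k) ≠ 0 := pow_ne_zero _ hq0
  have h1 : ∑' N : ℕ, peakWeight q N * baileySum q (pathCoeff q k h) N =
      ∑' n : ℤ, pathCoeff q k h n * gaussSum q n := by
    simp only [gaussSum, ← tsum_mul_left]
    rw [Summable.tsum_comm (f := fun (N : ℕ) (n : ℤ) => pathCoeff q k h n *
      (peakWeight q N * (invPoch q (N - n) * invPoch q (N + n)))) hsum]
    refine tsum_congr fun N => ?_
    rw [baileySum, ← tsum_mul_left]
    exact tsum_congr fun n => by ring
  have hY : Summable fun n : ℤ => pathCoeff q k h n * gaussSum q n := by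
    have := hsum.prod_symm.prod
    simpa only [Prod.swap, tsum_mul_left, gaussSum] using this
  have hY' : Summable fun n : ℤ => pathCoeff q k h (-n) * gaussSum q (-n) :=
    (Equiv.neg ℤ).summable_iff.mpr hY
  have h2 : 2 * ∑' n : ℤ, pathCoeff q k h n * gaussSum q n =
      2 * (gaussSum q 0 * thetaSum q k h) := by
    conv_lhs => rw [two_mul]
    nth_rewrite 2 [← (Equiv.neg ℤ).tsum_eq]
    simp only [Equiv.neg_apply]
    rw [← hY.tsum_add hY', tsum_congr fun n => pathCoeff_mul_gaussSum_symm hq0 hq hk n,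
      tsum_mul_left, tsum_mul_left, Summable.tsum_finsetSum fun j hj =>
        ((summable_norm_thetaTerm hqk (hnorm j hj).1 (hnorm j hj).2).of_norm).mul_left _]
    congr 2
    refine Finset.sum_congr rfl fun j hj => ?_
    rw [tsum_mul_left, tsum_thetaTerm hqk (hnorm j hj).1 (hnorm j hj).2]
    rw [Finset.mem_range] at hj
    rw [div_eq_mul_inv, ← pow_sub₀ q hq0 (by lia), show 2 * k - (k - h + j) = k + h - j by lia]
  rw [h1]
  exact mul_left_cancel₀ two_ne_zero h2

lemma one_sub_pow_ne_zero {q : ℂ} (hq : ‖q‖ < 1) (N : ℕ) : 1 - q ^ (N + 1) ≠ 0 := by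
  rw [pow_succ']; exact one_sub_mul_pow_ne_zero hq hq N

lemma baileySum_one_zero {q : ℂ} (hq0 : q ≠ 0) (hq : ‖q‖ < 1) (N : ℕ) :
    baileySum q (pathCoeff q 1 0) (N + 1) = 0 := by
  have h1 := baileySum_sub hq0 hq 1 0 (N + 1)
  have h2 := baileySumAux_top q 1 (N + 1)
  rw [sub_self] at h2
  rw [h2, zero_sub, baileySum_neg_one] at h1
  have h3 : (1 - q ^ (N + 1)) * baileySum q (pathCoeff q 1 0) (N + 1) = 0 := by
    linear_combination h1
  exact (mul_eq_zero.mp h3).resolve_left (one_sub_pow_ne_zero hq N)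

lemma gaussSum_zero {q : ℂ} (hq0 : q ≠ 0) (hq : ‖q‖ < 1) :
    gaussSum q 0 = qPochInf (-q) q / qPochInf q q := by
  have h := tsum_peakWeight_mul_baileySum_eq_gaussSum hq0 hq (k := 1) (h := 0) one_pos
  rw [tsum_eq_single 0 fun N hN => by
    obtain ⟨M, rfl⟩ := Nat.exists_eq_succ_of_ne_zero hN
    simpa using Or.inr (baileySum_one_zero hq0 hq M)] at h
  rw [baileySum_zero] at h
  simp only [peakWeight, thetaSum, Finset.range_zero, Finset.prod_empty, mul_one, mul_zero, zero_add,
    Finset.sum_range_one, pow_zero, one_mul, add_zero, Nat.sub_zero, pow_one] at h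
  have h1 := qPochInf_mul_qPochInf_sq hq
  have h2 := qPochInf_neg_mul_qPochInf_odd hq
  rw [eq_div_iff (qPochInf_ne_zero hq hq), ← h1]
  linear_combination (-(qPochInf (-q) q)) * h -
    gaussSum q 0 * qPochInf q (q ^ 2) * qPochInf (q ^ 2) (q ^ 2) * h2

lemma tsum_peakWeight_mul_baileySum {q : ℂ} (hq0 : q ≠ 0) (hq : ‖q‖ < 1) {k h : ℕ} (hk : h < k) :
    ∑' N : ℕ, peakWeight q N * baileySum q (pathCoeff q k h) N =
      qPochInf (-q) q / qPochInf q q * thetaSum q k h := by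
  rw [tsum_peakWeight_mul_baileySum_eq_gaussSum hq0 hq hk, gaussSum_zero hq0 hq]

/-! ### Peaks and major index, one step at a time -/

lemma isPeak_cons_succ (s : PStep) (l : List PStep) (m : ℕ) :
    IsPeak (s :: l) (m + 1) ↔ IsPeak l m := by
  simp [IsPeak]

lemma isPeak_cons_zero (s : PStep) (l : List PStep) :
    IsPeak (s :: l) 0 ↔ s = .NE ∧ (l.head? = some .SE ∨ l.head? = some .S) := by
  simp [IsPeak, List.head?_eq_getElem?]

lemma numPeaks_eq_sum (l : List PStep) :
    numPeaks l = ∑ m ∈ Finset.range l.length, if IsPeak l m then 1 else 0 := by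
  rw [numPeaks, Finset.card_filter]

/-- The number of peaks of `l`, where the initial vertex is counted as a peak if `b` holds
(meaning that it was reached by a North-East step) and `l` goes down from it. -/
def peaksFrom (b : Bool) (l : List PStep) : ℕ :=
  numPeaks l + if b = true ∧ (l.head? = some .SE ∨ l.head? = some .S) then 1 else 0

@[simp]
lemma peaksFrom_false (l : List PStep) : peaksFrom false l = numPeaks l := by
  simp [peaksFrom]

@[simp]
lemma numPeaks_nil : numPeaks [] = 0 := rfl

@[simp]
lemma majorIndex_nil : majorIndex [] = 0 := rfl

lemma numPeaks_cons (s : PStep) (l : List PStep) :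
    numPeaks (s :: l) = peaksFrom (decide (s = .NE)) l := by
  rw [numPeaks_eq_sum, List.length_cons, Finset.sum_range_succ']
  simp only [isPeak_cons_succ, isPeak_cons_zero, ← numPeaks_eq_sum, peaksFrom, decide_eq_true_eq]

lemma majorIndex_cons (s : PStep) (l : List PStep) :
    majorIndex (s :: l) = majorIndex l + stepDx s * peaksFrom (decide (s = .NE)) l := by
  have h : ∀ m, (if IsPeak (s :: l) (m + 1) then pathX ((s :: l).take (m + 1 + 1)) else 0) =
      (if IsPeak l m then pathX (l.take (m + 1)) else 0) +
        stepDx s * (if IsPeak l m then 1 else 0) := fun m => by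
    rw [List.take_succ_cons]
    by_cases hm : IsPeak l m <;> simp [isPeak_cons_succ, hm, pathX, add_comm]
  rw [majorIndex, List.length_cons, Finset.sum_range_succ', Finset.sum_congr rfl fun m _ => h m,
    Finset.sum_add_distrib, ← Finset.mul_sum, ← numPeaks_eq_sum, ← majorIndex, add_assoc]
  congr 1
  by_cases hs : s = .NE
  · subst hs
    simp [isPeak_cons_zero, peaksFrom, pathX, stepDx]
  · simp [isPeak_cons_zero, peaksFrom, hs]

/-! ### A recursive description of special paths -/

/-- `GoodFrom k h b l`: the steps `l` complete a path with heights below `k` when the current height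
is `h`, and `b` tells whether the last step was a North-East step. -/
def GoodFrom (k : ℕ) : ℕ → Bool → List PStep → Prop
  | h, _, [] => h = 0
  | h, _, .NE :: l => h + 1 < k ∧ GoodFrom k (h + 1) true l
  | h, _, .SE :: l => 1 ≤ h ∧ GoodFrom k (h - 1) false l
  | h, b, .S :: l => b = true ∧ 1 ≤ h ∧ GoodFrom k (h - 1) false l
  | h, _, .E :: l => h = 0 ∧ l ≠ [] ∧ GoodFrom k 0 false l

@[simp]
lemma pathHeight_nil (h : ℕ) : pathHeight h [] = h := by simp [pathHeight]

/-- The defining conditions of a special path, relative to an arbitrary starting vertex. -/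
def SpecialFrom (k h : ℕ) (b : Bool) (l : List PStep) : Prop :=
  (∀ m : ℕ, 0 ≤ pathHeight h (l.take m) ∧ pathHeight h (l.take m) < k) ∧
  (∀ m : ℕ, l[m]? = some PStep.S →
    (m = 0 ∧ b = true) ∨ ∃ m', m = m' + 1 ∧ l[m']? = some PStep.NE) ∧
  (∀ m : ℕ, l[m]? = some PStep.E → pathHeight h (l.take m) = 0) ∧
  pathHeight h l = 0 ∧
  (l = [] ∨ l.getLast? = some PStep.SE ∨ l.getLast? = some PStep.S)

lemma specialPath_iff_specialFrom (k i : ℕ) (l : List PStep) :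
    SpecialPath k i l ↔ SpecialFrom k (k - i) false l := by
  simp only [SpecialPath, ValidPath, SpecialFrom, forall_and, Bool.false_eq_true, and_false,
    false_or]
  tauto

lemma south_condition_cons (b : Bool) (s : PStep) (l : List PStep) :
    (∀ m : ℕ, (s :: l)[m]? = some PStep.S →
      (m = 0 ∧ b = true) ∨ ∃ m', m = m' + 1 ∧ (s :: l)[m']? = some PStep.NE) ↔
    (s = .S → b = true) ∧ ∀ m : ℕ, l[m]? = some PStep.S →
      (m = 0 ∧ decide (s = .NE) = true) ∨ ∃ m', m = m' + 1 ∧ l[m']? = some PStep.NE := by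
  rw [← Nat.and_forall_add_one]
  refine and_congr (by simp) (forall_congr' fun m => ?_)
  cases m <;> simp

lemma last_condition_cons (s : PStep) (l : List PStep) :
    ((s :: l) = [] ∨ (s :: l).getLast? = some PStep.SE ∨ (s :: l).getLast? = some PStep.S) ↔
    (l = [] → s = .SE ∨ s = .S) ∧
      (l = [] ∨ l.getLast? = some PStep.SE ∨ l.getLast? = some PStep.S) := by
  cases l <;> simp

lemma specialFrom_cons (k h h' : ℕ) (b : Bool) (s : PStep) (l : List PStep) (hk : h < k)
    (hh : (h' : ℤ) = h + stepDy s) :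
    SpecialFrom k h b (s :: l) ↔ (s = .S → b = true) ∧ (s = .E → h = 0) ∧
      (l = [] → s = .SE ∨ s = .S) ∧ SpecialFrom k h' (decide (s = .NE)) l := by
  have hheight : ∀ l', pathHeight h (s :: l') = pathHeight h' l' := fun l' => by
    simp only [pathHeight, List.map_cons, List.sum_cons, hh]; ring
  rw [SpecialFrom, SpecialFrom, south_condition_cons, last_condition_cons, ← Nat.and_forall_add_one,
    ← Nat.and_forall_add_one (p := fun m => (s :: l)[m]? = some PStep.E → _)]
  simp only [List.take_succ_cons, hheight, List.take_zero, pathHeight_nil, List.getElem?_cons_zero,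
    List.getElem?_cons_succ, Option.some.injEq, Nat.cast_eq_zero, Nat.cast_nonneg, Nat.cast_lt, hk,
    true_and]
  tauto

lemma specialFrom_nil (k h : ℕ) (b : Bool) (hk : h < k) : SpecialFrom k h b [] ↔ h = 0 := by
  simp [SpecialFrom, hk]

lemma SpecialFrom.start_lt {k h : ℕ} {b : Bool} {l : List PStep} (hl : SpecialFrom k h b l) :
    h < k := by
  simpa using (hl.1 0).2

lemma SpecialFrom.add_stepDy_nonneg {k h : ℕ} {b : Bool} {s : PStep} {l : List PStep}
    (hl : SpecialFrom k h b (s :: l)) : 0 ≤ (h : ℤ) + stepDy s := by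
  simpa [pathHeight] using (hl.1 1).1

lemma SpecialFrom.ne_nil {k h : ℕ} {b : Bool} {l : List PStep} (hl : SpecialFrom k (h + 1) b l) :
    l ≠ [] := by
  rintro rfl
  have := (specialFrom_nil k (h + 1) b hl.start_lt).mp hl
  lia

lemma specialFrom_iff_goodFrom {k : ℕ} (l : List PStep) :
    ∀ {h : ℕ} {b : Bool}, h < k → (SpecialFrom k h b l ↔ GoodFrom k h b l) := by
  induction l with
  | nil => intro h b hk; simp [specialFrom_nil k h b hk, GoodFrom]
  | cons s l ih =>
    intro h b hk
    cases s with
    | NE =>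
      rw [specialFrom_cons k h (h + 1) b .NE l hk (by simp [stepDy])]
      simp only [GoodFrom]
      constructor
      · rintro ⟨-, -, -, h4⟩
        exact ⟨h4.start_lt, (ih h4.start_lt).mp h4⟩
      · rintro ⟨h1, h2⟩
        have h3 := (ih h1).mpr h2
        exact ⟨by simp, by simp, fun hn => absurd hn h3.ne_nil, h3⟩
    | SE =>
      rcases h with _ | h
      · refine iff_of_false (fun hl => ?_) (by simp [GoodFrom])
        simpa [stepDy] using hl.add_stepDy_nonneg
      · rw [specialFrom_cons k (h + 1) h b .SE l hk (by simp [stepDy])]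
        simp [GoodFrom, ih (show h < k by lia)]
    | S =>
      rcases h with _ | h
      · refine iff_of_false (fun hl => ?_) (by simp [GoodFrom])
        simpa [stepDy] using hl.add_stepDy_nonneg
      · rw [specialFrom_cons k (h + 1) h b .S l hk (by simp [stepDy])]
        simp [GoodFrom, ih (show h < k by lia)]
    | E =>
      rw [specialFrom_cons k h h b .E l hk (by simp [stepDy])]
      simp only [GoodFrom, ne_eq]
      constructor
      · rintro ⟨-, h2, h3, h4⟩
        obtain rfl : h = 0 := by simpa using h2
        exact ⟨rfl, fun hn => by simpa using h3 hn, (ih hk).mp h4⟩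
      · rintro ⟨rfl, h2, h3⟩
        exact ⟨by simp, by simp, fun hn => absurd hn h2, (ih hk).mpr h3⟩

lemma specialPath_iff_goodFrom {k i : ℕ} (hi : 1 ≤ i) (hik : i ≤ k) (l : List PStep) :
    SpecialPath k i l ↔ GoodFrom k (k - i) false l :=
  (specialPath_iff_specialFrom k i l).trans (specialFrom_iff_goodFrom l (by lia))

lemma GoodFrom.one_le_peaksFrom_true {k : ℕ} (l : List PStep) :
    ∀ {h : ℕ}, GoodFrom k (h + 1) true l → 1 ≤ peaksFrom true l := by
  induction l with
  | nil => intro h hl; simp [GoodFrom] at hl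
  | cons s l ih =>
    intro h hl
    cases s with
    | NE =>
      have := ih hl.2
      simp [peaksFrom, numPeaks_cons] at this ⊢
      exact this
    | SE => simp [peaksFrom]
    | S => simp [peaksFrom]
    | E => simp [GoodFrom] at hl

lemma GoodFrom.one_le_numPeaks {k : ℕ} (l : List PStep) (hl : GoodFrom k 0 false l) (hn : l ≠ []) :
    1 ≤ numPeaks l := by
  induction l with
  | nil => exact absurd rfl hn
  | cons s l ih =>
    cases s with
    | NE => simpa [numPeaks_cons] using GoodFrom.one_le_peaksFrom_true l hl.2
    | SE => simp [GoodFrom] at hl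
    | S => simp [GoodFrom] at hl
    | E => simpa [numPeaks_cons] using ih hl.2.2 hl.2.1

/-! ### Weights of paths -/

section Weights

variable {R : Type*} [CommSemiring R] (x : R) (k : ℕ)

/-- The weight `x^maj` of a path completion with `N` peaks, and `0` for all other lists. -/
noncomputable def pathTerm (h : ℕ) (b : Bool) (N : ℕ) (l : List PStep) : R :=
  if GoodFrom k h b l ∧ peaksFrom b l = N then x ^ majorIndex l else 0

lemma pathTerm_nil (h N : ℕ) :
    pathTerm x k h false N [] = if h = 0 ∧ N = 0 then 1 else 0 := by
  simp [pathTerm, GoodFrom, eq_comm]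

lemma pathTerm_true_nil (h N : ℕ) : pathTerm x k (h + 1) true N [] = 0 := by
  simp [pathTerm, GoodFrom]

lemma pathTerm_NE (h : ℕ) (b : Bool) (N : ℕ) (l : List PStep) :
    pathTerm x k h b N (.NE :: l) =
      if h + 1 < k then x ^ N * pathTerm x k (h + 1) true N l else 0 := by
  have h1 : peaksFrom b (.NE :: l) = peaksFrom true l := by
    simp [peaksFrom, numPeaks_cons]
  simp only [pathTerm, GoodFrom, h1, majorIndex_cons, stepDx]
  split_ifs <;> simp_all [pow_add, mul_comm]

lemma pathTerm_SE (h N : ℕ) (l : List PStep) :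
    pathTerm x k (h + 1) false N (.SE :: l) = x ^ N * pathTerm x k h false N l := by
  simp only [pathTerm, GoodFrom, majorIndex_cons, stepDx, numPeaks_cons, peaksFrom_false]
  split_ifs <;> simp_all [pow_add, mul_comm]

lemma pathTerm_zero_SE (b : Bool) (N : ℕ) (l : List PStep) :
    pathTerm x k 0 b N (.SE :: l) = 0 := by
  simp [pathTerm, GoodFrom]

lemma pathTerm_S (h N : ℕ) (l : List PStep) : pathTerm x k h false N (.S :: l) = 0 := by
  simp [pathTerm, GoodFrom]

lemma pathTerm_true_SE (h N : ℕ) (l : List PStep) :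
    pathTerm x k (h + 1) true (N + 1) (.SE :: l) = x ^ N * pathTerm x k h false N l := by
  have h1 : peaksFrom true (.SE :: l) = numPeaks l + 1 := by simp [peaksFrom, numPeaks_cons]
  simp only [pathTerm, GoodFrom, h1, majorIndex_cons, stepDx, peaksFrom_false]
  split_ifs <;> simp_all [pow_add, mul_comm]

lemma pathTerm_true_S (h N : ℕ) (l : List PStep) :
    pathTerm x k (h + 1) true (N + 1) (.S :: l) = pathTerm x k h false N l := by
  have h1 : peaksFrom true (.S :: l) = numPeaks l + 1 := by simp [peaksFrom, numPeaks_cons]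
  simp [pathTerm, GoodFrom, h1, majorIndex_cons, stepDx]

lemma pathTerm_true_zero (h : ℕ) (l : List PStep) : pathTerm x k (h + 1) true 0 l = 0 :=
  if_neg fun hl => by
    have := GoodFrom.one_le_peaksFrom_true l hl.1
    lia

lemma pathTerm_E_succ (N : ℕ) (l : List PStep) :
    pathTerm x k 0 false (N + 1) (.E :: l) = x ^ (N + 1) * pathTerm x k 0 false (N + 1) l := by
  simp only [pathTerm, GoodFrom, majorIndex_cons, stepDx, numPeaks_cons, peaksFrom_false]
  rcases eq_or_ne l [] with rfl | hl
  · simp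
  · split_ifs <;> simp_all [pow_add, mul_comm]

lemma pathTerm_E_zero (h : ℕ) (l : List PStep) : pathTerm x k h false 0 (.E :: l) = 0 :=
  if_neg fun hl => by
    obtain ⟨⟨rfl, hn, hg⟩, hp⟩ := hl
    have := GoodFrom.one_le_numPeaks l hg hn
    simp [numPeaks_cons] at hp
    lia

lemma pathTerm_succ_E (h : ℕ) (b : Bool) (N : ℕ) (l : List PStep) :
    pathTerm x k (h + 1) b N (.E :: l) = 0 := by
  simp [pathTerm, GoodFrom]

end Weights

/-- Summation over all lists of steps according to the first step. -/
lemma hasSum_list_pStep {M : Type*} [AddCommMonoid M] [TopologicalSpace M] [ContinuousAdd M]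
    {f : List PStep → M} {a : PStep → M} (h : ∀ s, HasSum (fun l => f (s :: l)) (a s)) :
    HasSum f (f [] + a .NE + a .SE + a .S + a .E) := by
  have key : ∀ s, HasSum (fun l : List PStep => if l.head? = some s then f l else 0) (a s) := by
    intro s
    rw [← Function.Injective.hasSum_iff (List.cons_injective (a := s))]
    · simpa [Function.comp_def] using h s
    · intro l hl
      refine if_neg fun hs => hl ?_
      obtain ⟨t, rfl⟩ := List.head?_eq_some_iff.mp hs
      exact ⟨t, rfl⟩
  have hnil : HasSum (fun l : List PStep => if l = [] then f l else 0) (f []) := by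
    simpa using hasSum_single (f := fun l : List PStep => if l = [] then f l else 0) []
      fun l hl => if_neg hl
  convert (((hnil.add (key .NE)).add (key .SE)).add (key .S)).add (key .E) using 2 with l
  rcases l with _ | ⟨s, l⟩
  · simp
  · cases s <;> simp

/-! ### Summability of the path weights -/

open scoped ENNReal NNReal

lemma tsum_list_pStep (f : List PStep → ℝ≥0∞) :
    ∑' l, f l = f [] + ∑' l, f (.NE :: l) + ∑' l, f (.SE :: l) + ∑' l, f (.S :: l) +
      ∑' l, f (.E :: l) :=
  (hasSum_list_pStep (a := fun s => ∑' l, f (s :: l)) fun _ => ENNReal.summable.hasSum).tsum_eq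

/-- The weights of the path completions with fewer than `L` steps. -/
noncomputable def shortSum (x : ℝ≥0∞) (k L h : ℕ) (b : Bool) (N : ℕ) : ℝ≥0∞ :=
  ∑' l : List PStep, if l.length < L then pathTerm x k h b N l else 0

lemma shortSum_zero (x : ℝ≥0∞) (k h : ℕ) (b : Bool) (N : ℕ) : shortSum x k 0 h b N = 0 := by
  simp [shortSum]

lemma shortSum_succ (x : ℝ≥0∞) (k L h : ℕ) (b : Bool) (N : ℕ) :
    shortSum x k (L + 1) h b N = pathTerm x k h b N [] +
      (∑' l, if l.length < L then pathTerm x k h b N (.NE :: l) else 0) +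
      (∑' l, if l.length < L then pathTerm x k h b N (.SE :: l) else 0) +
      (∑' l, if l.length < L then pathTerm x k h b N (.S :: l) else 0) +
      (∑' l, if l.length < L then pathTerm x k h b N (.E :: l) else 0) := by
  rw [shortSum, tsum_list_pStep]
  simp

lemma tsum_ite_mul_left (c : ℝ≥0∞) (L : ℕ) (f : List PStep → ℝ≥0∞) :
    (∑' l, if l.length < L then c * f l else 0) = c * ∑' l, if l.length < L then f l else 0 := by
  rw [← ENNReal.tsum_mul_left]
  exact tsum_congr fun l => by split_ifs <;> simp

lemma shortSum_NE_le (x : ℝ≥0∞) (k L h : ℕ) (b : Bool) (N : ℕ) :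
    (∑' l, if l.length < L then pathTerm x k h b N (.NE :: l) else 0) ≤
      x ^ N * shortSum x k L (h + 1) true N := by
  rw [shortSum, ← tsum_ite_mul_left]
  refine ENNReal.tsum_le_tsum fun l => ?_
  rw [pathTerm_NE]
  split_ifs <;> simp

lemma shortSum_false_zero_le (x : ℝ≥0∞) (k L : ℕ) : ∀ h, shortSum x k L h false 0 ≤ 1 := by
  induction L with
  | zero => intro h; simp [shortSum_zero]
  | succ L ih =>
    intro h
    rw [shortSum_succ]
    have hNE := shortSum_NE_le x k L h false 0
    have hz : shortSum x k L (h + 1) true 0 = 0 := by simp [shortSum, pathTerm_true_zero]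
    rw [hz, mul_zero, nonpos_iff_eq_zero] at hNE
    rw [hNE, pathTerm_nil]
    rcases h with _ | h
    · simp [pathTerm_zero_SE, pathTerm_S, pathTerm_E_zero]
    · simpa [pathTerm_SE, pathTerm_S, pathTerm_E_zero, shortSum] using ih h

lemma shortSum_true_succ_le {x c D : ℝ≥0∞} (hx : x ≤ 1) (hc : 1 + x * c = c) {k N : ℕ}
    (hD : ∀ L h, shortSum x k L h false N ≤ D) (L : ℕ) :
    ∀ h, shortSum x k L (h + 1) true (N + 1) ≤ 2 * D * c := by
  induction L with
  | zero => intro h; simp [shortSum_zero]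
  | succ L ih =>
    intro h
    rw [shortSum_succ, pathTerm_true_nil]
    simp only [pathTerm_true_SE, pathTerm_true_S, pathTerm_succ_E, tsum_ite_mul_left, ite_self,
      tsum_zero, add_zero, zero_add]
    rw [← shortSum]
    calc _ ≤ x * (2 * D * c) + 1 * D + D := by
          gcongr
          · refine (shortSum_NE_le x k L (h + 1) true (N + 1)).trans ?_
            gcongr
            · exact pow_le_of_le_one zero_le hx N.succ_ne_zero
            · exact ih (h + 1)
          · exact pow_le_one' hx N
          · exact hD L h
          · exact hD L h
      _ = 2 * D * (1 + x * c) := by ring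
      _ = 2 * D * c := by rw [hc]

lemma shortSum_false_succ_le {x c D : ℝ≥0∞} (hx : x ≤ 1) (hc : 1 + x * c = c) {k N : ℕ}
    (hD : ∀ L h, shortSum x k L h false N ≤ D) (L : ℕ) :
    ∀ h, shortSum x k L h false (N + 1) ≤ 2 * c ^ 2 * x ^ (N + 1) * D := by
  induction L with
  | zero => intro h; simp [shortSum_zero]
  | succ L ih =>
    intro h
    have hNE : (∑' l, if l.length < L then pathTerm x k h false (N + 1) (.NE :: l) else 0) ≤
        x ^ (N + 1) * (2 * D * c) :=
      (shortSum_NE_le x k L h false (N + 1)).trans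
        (mul_le_mul_right (shortSum_true_succ_le hx hc hD L h) _)
    have hle : x ^ (N + 1) * (2 * D * c) + x ^ (N + 1) * (2 * c ^ 2 * x ^ (N + 1) * D) ≤
        2 * c ^ 2 * x ^ (N + 1) * D := by
      calc _ ≤ x ^ (N + 1) * (2 * D * c) + x ^ (N + 1) * (2 * c ^ 2 * x * D) := by
            gcongr
            exact pow_le_of_le_one zero_le hx N.succ_ne_zero
        _ = 2 * c * x ^ (N + 1) * D * (1 + x * c) := by ring
        _ = 2 * c ^ 2 * x ^ (N + 1) * D := by rw [hc]; ring
    refine le_trans ?_ hle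
    rw [shortSum_succ, pathTerm_nil, if_neg (by lia)]
    rcases h with _ | h
    · simp only [pathTerm_zero_SE, pathTerm_S, pathTerm_E_succ, tsum_ite_mul_left, ite_self,
        tsum_zero, add_zero, zero_add]
      rw [← shortSum]
      gcongr
      exact ih 0
    · simp only [pathTerm_SE, pathTerm_S, pathTerm_succ_E, tsum_ite_mul_left, ite_self, tsum_zero,
        add_zero, zero_add]
      rw [← shortSum]
      gcongr
      exact ih h

lemma shortSum_le {x c : ℝ≥0∞} (hx : x ≤ 1) (hc : 1 + x * c = c) (k N : ℕ) :
    ∀ L h, shortSum x k L h false N ≤ ∏ j ∈ Finset.range N, (2 * c ^ 2 * x ^ (j + 1)) := by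
  induction N with
  | zero => intro L h; simpa using shortSum_false_zero_le x k L h
  | succ N ih =>
    intro L h
    rw [Finset.prod_range_succ, mul_comm]
    exact shortSum_false_succ_le hx hc ih L h

lemma tsum_pathTerm_le {x c : ℝ≥0∞} (hx : x ≤ 1) (hc : 1 + x * c = c) (k h N : ℕ) :
    ∑' l, pathTerm x k h false N l ≤ ∏ j ∈ Finset.range N, (2 * c ^ 2 * x ^ (j + 1)) := by
  rw [ENNReal.tsum_eq_iSup_sum]
  refine iSup_le fun s => ?_
  refine le_trans ?_ (shortSum_le hx hc k N (s.sup List.length + 1) h)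
  refine le_trans (Finset.sum_le_sum fun l hl => ?_) (ENNReal.sum_le_tsum s)
  rw [if_pos (Nat.lt_succ_of_le (Finset.le_sup (f := List.length) hl))]

lemma summable_prod_mul_pow {C r : ℝ} (hC : 0 < C) (hr0 : 0 < r) (hr1 : r < 1) :
    Summable fun N : ℕ => ∏ j ∈ Finset.range N, (C * r ^ (j + 1)) := by
  have hpos : ∀ N : ℕ, 0 < ∏ j ∈ Finset.range N, (C * r ^ (j + 1)) := fun N =>
    Finset.prod_pos fun j _ => by positivity
  refine summable_of_ratio_test_tendsto_lt_one zero_lt_one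
    (Eventually.of_forall fun N => (hpos N).ne') ?_
  have hlim : Tendsto (fun N : ℕ => C * r ^ (N + 1)) atTop (𝓝 0) := by
    simpa using ((tendsto_pow_atTop_nhds_zero_of_lt_one hr0.le hr1).comp
      (tendsto_add_atTop_nat 1)).const_mul C
  refine hlim.congr fun N => ?_
  rw [Finset.prod_range_succ, norm_mul, mul_div_cancel_left₀ _ (norm_ne_zero_iff.mpr (hpos N).ne'),
    Real.norm_of_nonneg (by positivity)]

/-- The weight `q^maj` of a path completion, and `0` for all other lists. -/
noncomputable def goodTerm (q : ℂ) (k h : ℕ) (l : List PStep) : ℂ :=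
  if GoodFrom k h false l then q ^ majorIndex l else 0

lemma summable_norm_goodTerm {q : ℂ} (hq0 : q ≠ 0) (hq : ‖q‖ < 1) (k h : ℕ) :
    Summable fun l => ‖goodTerm q k h l‖ := by
  have hr0 : 0 < ‖q‖ := norm_pos_iff.mpr hq0
  have h1r : 0 < 1 - ‖q‖ := sub_pos.mpr hq
  obtain ⟨c, hc'⟩ : ∃ c : ℝ≥0, (c : ℝ) = (1 - ‖q‖)⁻¹ := ⟨⟨_, by positivity⟩, rfl⟩
  have hc : 1 + ‖q‖₊ * c = c := by
    refine NNReal.eq ?_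
    push_cast
    rw [hc']
    field_simp
    ring
  have hterm : ∀ l, (‖goodTerm q k h l‖₊ : ℝ≥0∞) =
      ∑' N, pathTerm (‖q‖₊ : ℝ≥0∞) k h false N l := fun l => by
    rw [tsum_eq_single (numPeaks l) fun N hN =>
      show pathTerm (‖q‖₊ : ℝ≥0∞) k h false N l = 0 from
        if_neg fun hl => hN (by simpa using hl.2.symm)]
    by_cases hl : GoodFrom k h false l <;> simp [goodTerm, pathTerm, hl]
  have hsum : Summable fun N : ℕ => ∏ j ∈ Finset.range N, (2 * c ^ 2 * ‖q‖₊ ^ (j + 1)) := by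
    rw [← NNReal.summable_coe]
    push_cast
    refine summable_prod_mul_pow ?_ hr0 hq
    rw [hc']
    positivity
  have hne : ∑' l, (‖goodTerm q k h l‖₊ : ℝ≥0∞) ≠ ∞ := by
    simp only [hterm]
    rw [ENNReal.tsum_comm]
    refine ne_top_of_le_ne_top (ENNReal.tsum_coe_ne_top_iff_summable.mpr hsum)
      (ENNReal.tsum_le_tsum fun N => ?_)
    push_cast
    exact tsum_pathTerm_le (by exact_mod_cast hq.le) (by exact_mod_cast hc) k h N
  exact NNReal.summable_coe.mpr (ENNReal.tsum_coe_ne_top_iff_summable.mp hne)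

lemma hasSum_tsum_pathTerm {q : ℂ} (hq0 : q ≠ 0) (hq : ‖q‖ < 1) (k h : ℕ) :
    HasSum (fun N => ∑' l, pathTerm q k h false N l) (∑' l, goodTerm q k h l) := by
  have hfiber : (fun N => ∑' l, pathTerm q k h false N l) =
      fun N => ∑' l : numPeaks ⁻¹' {N}, goodTerm q k h l := by
    ext N
    rw [tsum_subtype]
    refine tsum_congr fun l => ?_
    by_cases h1 : GoodFrom k h false l <;> by_cases h2 : numPeaks l = N <;>
      simp [pathTerm, goodTerm, Set.indicator, h1, h2]
  rw [hfiber]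
  exact (summable_norm_goodTerm hq0 hq k h).of_norm.hasSum.tsum_fiberwise numPeaks

lemma summable_pathTerm {q : ℂ} (hq0 : q ≠ 0) (hq : ‖q‖ < 1) (k h N : ℕ) :
    Summable (pathTerm q k h false N) := by
  refine Summable.of_norm_bounded (summable_norm_goodTerm hq0 hq k h) fun l => ?_
  by_cases hl : GoodFrom k h false l
  · simp only [pathTerm, goodTerm, hl, true_and, if_true]
    split_ifs <;> simp
  · simp [pathTerm, hl]

lemma summable_pathTerm_true {q : ℂ} (hq0 : q ≠ 0) (hq : ‖q‖ < 1) {k h : ℕ} (hk : h + 1 < k)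
    (N : ℕ) : Summable (pathTerm q k (h + 1) true N) := by
  have h1 := (summable_pathTerm hq0 hq k h N).comp_injective (List.cons_injective (a := PStep.NE))
  refine (summable_mul_left_iff (pow_ne_zero N hq0)).mp (h1.congr fun l => ?_)
  rw [Function.comp_apply, pathTerm_NE, if_pos hk]

/-! ### Generating functions of paths with a given number of peaks -/

/-- The generating function of the paths from height `h` with `N` peaks. -/
noncomputable def pathSum (q : ℂ) (k h N : ℕ) : ℂ := ∑' l, pathTerm q k h false N l

/-- The generating function of the paths from height `h` with `N` peaks that start with a North-East
step. -/
noncomputable def riseSum (q : ℂ) (k h N : ℕ) : ℂ := ∑' l, pathTerm q k h false N (.NE :: l)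

lemma tsum_list_pStep_of_summable {f : List PStep → ℂ} (hf : Summable f) :
    ∑' l, f l = f [] + ∑' l, f (.NE :: l) + ∑' l, f (.SE :: l) + ∑' l, f (.S :: l) +
      ∑' l, f (.E :: l) :=
  (hasSum_list_pStep (a := fun s => ∑' l, f (s :: l)) fun _ =>
    (hf.comp_injective List.cons_injective).hasSum).tsum_eq

lemma riseSum_zero (q : ℂ) (k h : ℕ) : riseSum q k h 0 = 0 := by
  simp [riseSum, pathTerm_NE, pathTerm_true_zero]

lemma riseSum_top (q : ℂ) {k h : ℕ} (hk : k ≤ h + 1) (N : ℕ) : riseSum q k h N = 0 := by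
  simp [riseSum, pathTerm_NE, hk.not_gt]

lemma pathSum_zero {q : ℂ} (hq0 : q ≠ 0) (hq : ‖q‖ < 1) (k h : ℕ) : pathSum q k h 0 = 1 := by
  induction h with
  | zero =>
    rw [pathSum, tsum_list_pStep_of_summable (summable_pathTerm hq0 hq k 0 0), ← riseSum]
    simp [riseSum_zero, pathTerm_nil, pathTerm_zero_SE, pathTerm_S, pathTerm_E_zero]
  | succ h ih =>
    rw [pathSum, tsum_list_pStep_of_summable (summable_pathTerm hq0 hq k (h + 1) 0), ← riseSum]
    simpa [riseSum_zero, pathTerm_nil, pathTerm_SE, pathTerm_S, pathTerm_E_zero, pathSum] using ih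

lemma pathSum_zero_succ {q : ℂ} (hq0 : q ≠ 0) (hq : ‖q‖ < 1) (k N : ℕ) :
    pathSum q k 0 (N + 1) = riseSum q k 0 (N + 1) + q ^ (N + 1) * pathSum q k 0 (N + 1) := by
  conv_lhs =>
    rw [pathSum, tsum_list_pStep_of_summable (summable_pathTerm hq0 hq k 0 (N + 1)), ← riseSum]
  simp [pathTerm_nil, pathTerm_zero_SE, pathTerm_S, pathTerm_E_succ, tsum_mul_left, pathSum]

lemma pathSum_succ_succ {q : ℂ} (hq0 : q ≠ 0) (hq : ‖q‖ < 1) (k h N : ℕ) :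
    pathSum q k (h + 1) (N + 1) =
      riseSum q k (h + 1) (N + 1) + q ^ (N + 1) * pathSum q k h (N + 1) := by
  rw [pathSum, tsum_list_pStep_of_summable (summable_pathTerm hq0 hq k (h + 1) (N + 1)), ← riseSum]
  simp [pathTerm_nil, pathTerm_SE, pathTerm_S, pathTerm_succ_E, tsum_mul_left, pathSum]

lemma riseSum_succ {q : ℂ} (hq0 : q ≠ 0) (hq : ‖q‖ < 1) {k h : ℕ}
    (hk : h + 1 < k) (N : ℕ) :
    riseSum q k h (N + 1) =
      q ^ (N + 1) * ((1 + q ^ N) * pathSum q k h N + riseSum q k (h + 1) (N + 1)) := by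
  have hNE : ∀ l, pathTerm q k (h + 1) true (N + 1) (.NE :: l) =
      pathTerm q k (h + 1) false (N + 1) (.NE :: l) := fun l => by
    rw [pathTerm_NE, pathTerm_NE]
  simp only [riseSum, pathTerm_NE q k h, if_pos hk, tsum_mul_left]
  rw [tsum_list_pStep_of_summable (summable_pathTerm_true hq0 hq hk (N + 1))]
  simp only [hNE, pathTerm_true_nil, pathTerm_true_SE, pathTerm_true_S, pathTerm_succ_E,
    tsum_mul_left, tsum_zero, pathSum]
  ring

lemma riseSum_eq {q : ℂ} (hq0 : q ≠ 0) (hq : ‖q‖ < 1) {k N : ℕ}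
    (ih : ∀ h : ℕ, h < k →
      pathSum q k h N = peakWeight q N * baileySum q (pathCoeff q k h) N) (m : ℕ) :
    ∀ h : ℕ, h + 1 + m = k →
      riseSum q k h (N + 1) = peakWeight q (N + 1) * baileySumAux q (pathCoeff q k h) (N + 1) := by
  induction m with
  | zero =>
    intro h hh
    have htop := baileySumAux_top q k (N + 1)
    rw [show (k : ℤ) - 1 = h by lia] at htop
    rw [riseSum_top q (by lia), htop, mul_zero]
  | succ m ihm =>
    intro h hh
    have hrec := baileySumAux_sub hq0 hq k h N
    have hnext := ihm (h + 1) (by lia)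
    push_cast at hnext
    rw [riseSum_succ hq0 hq (by lia), ih h (by lia), hnext, ← hrec, peakWeight_succ]
    ring

lemma pathSum_eq {q : ℂ} (hq0 : q ≠ 0) (hq : ‖q‖ < 1) (k N : ℕ) : ∀ h : ℕ, h < k →
    pathSum q k h N = peakWeight q N * baileySum q (pathCoeff q k h) N := by
  induction N with
  | zero =>
    intro h _
    simp [pathSum_zero hq0 hq, baileySum_zero, peakWeight]
  | succ N ih =>
    have hrise : ∀ h : ℕ, h < k → riseSum q k h (N + 1) =
        peakWeight q (N + 1) * baileySumAux q (pathCoeff q k h) (N + 1) := fun h hh =>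
      riseSum_eq hq0 hq ih (k - (h + 1)) h (by lia)
    intro h
    induction h with
    | zero =>
      intro hk
      have hrec := baileySum_sub hq0 hq k 0 (N + 1)
      rw [zero_sub, baileySum_neg_one] at hrec
      have hsum := pathSum_zero_succ hq0 hq k N
      have hr := hrise 0 hk
      push_cast at hr ⊢
      rw [hr, ← hrec] at hsum
      refine mul_left_cancel₀ (one_sub_pow_ne_zero hq N) ?_
      linear_combination hsum
    | succ h ihh =>
      intro hk
      have hrec := baileySum_sub hq0 hq k (h + 1) (N + 1)
      rw [add_sub_cancel_right] at hrec
      have hr := hrise (h + 1) hk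
      push_cast at hr ⊢
      rw [pathSum_succ_succ hq0 hq, hr, ihh (by lia), ← hrec]
      ring

lemma tsum_goodTerm {q : ℂ} (hq0 : q ≠ 0) (hq : ‖q‖ < 1) {k h : ℕ} (hk : h < k) :
    ∑' l, goodTerm q k h l = qPochInf (-q) q / qPochInf q q * thetaSum q k h := by
  rw [← (hasSum_tsum_pathTerm hq0 hq k h).tsum_eq, ← tsum_peakWeight_mul_baileySum hq0 hq hk]
  exact tsum_congr fun N => pathSum_eq hq0 hq k N h hk

lemma tsum_Ebar_mul_pow {q : ℂ} (hq0 : q ≠ 0) (hq : ‖q‖ < 1) {k i : ℕ} (hi : 1 ≤ i) (hik : i ≤ k) :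
    ∑' p : ℕ × ℕ, (Ebar k i p.1 p.2 : ℂ) * q ^ p.1 = ∑' l, goodTerm q k (k - i) l := by
  have hsum : Summable (goodTerm q k (k - i)) := (summable_norm_goodTerm hq0 hq k (k - i)).of_norm
  have hind : goodTerm q k (k - i) =
      Set.indicator {l | SpecialPath k i l} fun l => q ^ majorIndex l := by
    ext l
    simp [goodTerm, Set.indicator, specialPath_iff_goodFrom hi hik]
  rw [hind, ← tsum_subtype]
  rw [hind, ← summable_subtype_iff_indicator, Function.comp_def] at hsum
  rw [← (hsum.hasSum.tsum_fiberwise fun l => (majorIndex l.1, southSteps l.1)).tsum_eq]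
  refine tsum_congr fun p => ?_
  have hfiber : ∀ l : (fun l : {l | SpecialPath k i l} => (majorIndex l.1, southSteps l.1)) ⁻¹' {p},
      q ^ majorIndex l.1.1 = q ^ p.1 := fun l => congrArg (q ^ ·) (congrArg Prod.fst l.2)
  rw [tsum_congr hfiber, tsum_const, nsmul_eq_mul, Ebar]
  congr 2
  refine Nat.card_congr ⟨fun l => ⟨⟨l.1, l.2.1⟩, Prod.ext l.2.2.1 l.2.2.2⟩,
    fun l => ⟨l.1.1, l.1.2, congrArg Prod.fst l.2, congrArg Prod.snd l.2⟩,
    fun _ => rfl, fun _ => rfl⟩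

lemma thetaSum_sub (q : ℂ) {k i : ℕ} (hik : i ≤ k) :
    thetaSum q k (k - i) = ∑ j ∈ Finset.range (2 * (k - i) + 1), (-1 : ℂ) ^ j *
      (qPochInf (q ^ (i + j)) (q ^ (2 * k)) * qPochInf (q ^ (2 * k - i - j)) (q ^ (2 * k)) *
        qPochInf (q ^ (2 * k)) (q ^ (2 * k))) := by
  refine Finset.sum_congr rfl fun j _ => ?_
  rw [show k - (k - i) + j = i + j by lia, show k + (k - i) - j = 2 * k - i - j by lia]

/-- **Corollary 1.6, equation (1.5).** For `k ≥ i ≥ 1` and `0 < |q| < 1`,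
`Σ_{n,j} Ē_{k,i}(n,j) qⁿ = ((-q;q)_∞/(q;q)_∞) Σ_{j=0}^{2(k-i)} (-1)ʲ (q^{i+j}, q^{2k-i-j}, q^{2k}; q^{2k})_∞`. -/
theorem gen_fun_E_a_one (k i : ℕ) (hi : 1 ≤ i) (hik : i ≤ k) (q : ℂ)
    (hq0 : 0 < ‖q‖) (hq1 : ‖q‖ < 1) :
    ∑' p : ℕ × ℕ, (Ebar k i p.1 p.2 : ℂ) * q ^ p.1 =
      qPochInf (-q) q / qPochInf q q *
        ∑ j ∈ Finset.range (2 * (k - i) + 1), (-1 : ℂ) ^ j *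
          (qPochInf (q ^ (i + j)) (q ^ (2 * k)) * qPochInf (q ^ (2 * k - i - j)) (q ^ (2 * k)) *
            qPochInf (q ^ (2 * k)) (q ^ (2 * k))) := by
  have hq : q ≠ 0 := norm_pos_iff.mp hq0
  rw [tsum_Ebar_mul_pow hq hq1 hi hik, tsum_goodTerm hq hq1 (by lia), thetaSum_sub q hik]

end Paper
end

section
/- For every nonnegative integer N, the generating function for overpartitions with generalized Durfee square of size exactly N, where the exponent of q records the weight and the exponent of a records the number of overlined parts, equals a^N q^{N(N+1)/2} (−1/a;q)_N / ((q;q)_N (q;q)_N); equivalently, the number of overpartitions of n with j overlined parts and generalized Durfee square of size N is the coefficient of q^n a^j in this expression. -/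
namespace Paper

/-- An overpartition is represented as a list of pairs `(part, overlined?)`.
Parts are positive, the list is non-increasing in the part sizes, and among
equal parts only the final occurrence may be overlined. -/
def IsOverpartition (l : List (ℕ × Bool)) : Prop :=
  (∀ p ∈ l, 1 ≤ p.1) ∧
  l.Chain' fun x y => y.1 < x.1 ∨ (x.1 = y.1 ∧ x.2 = false)

/-- The weight of an overpartition: the sum of its parts. -/
def opWeight (l : List (ℕ × Bool)) : ℕ := (l.map Prod.fst).sum

/-- The number of overlined parts. -/
def opOverlined (l : List (ℕ × Bool)) : ℕ := (l.filter fun p => p.2).length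

/-- The difference condition of Gordon type: `λ_ℓ - λ_{ℓ+k-1} ≥ 1` if `λ_{ℓ+k-1}` is
overlined and `λ_ℓ - λ_{ℓ+k-1} ≥ 2` otherwise (indices `0`-based). -/
def GapCond (k : ℕ) (l : List (ℕ × Bool)) : Prop :=
  ∀ m : ℕ, m + (k - 1) < l.length →
    (l.getD (m + (k - 1)) (0, false)).1 +
      (if (l.getD (m + (k - 1)) (0, false)).2 then 1 else 2) ≤ (l.getD m (0, false)).1

/-- Overpartitions counted by `B̄_{k,i}`: the Gordon difference condition holds and at
most `i - 1` parts are equal to `1`. -/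
def BCond (k i : ℕ) (l : List (ℕ × Bool)) : Prop :=
  IsOverpartition l ∧ GapCond k l ∧ (l.filter fun p => p.1 == 1).length ≤ i - 1

/-- `Bbar k i n j` : the number of overpartitions of `n` with `j` overlined parts
satisfying the `B̄_{k,i}` conditions. -/
noncomputable def Bbar (k i n j : ℕ) : ℕ :=
  Nat.card {l : List (ℕ × Bool) //
    BCond k i l ∧ opWeight l = n ∧ opOverlined l = j}

/-- The Frobenius representation of an overpartition: a two-rowed array whose top row
is a partition into distinct nonnegative parts and whose bottom row is an
overpartition into nonnegative parts where the first occurrence of a part may be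
overlined. -/
structure FrobSym : Type where
  top : List ℕ
  bot : List (ℕ × Bool)
  top_sorted : top.Chain' (· > ·)
  bot_sorted : bot.Chain' fun x y => y.1 < x.1 ∨ (x.1 = y.1 ∧ y.2 = false)
  len_eq : top.length = bot.length

/-- The number of columns of a Frobenius symbol. -/
def frobCols (F : FrobSym) : ℕ := F.top.length

/-- The weight of the overpartition represented by a Frobenius symbol. -/
def frobWeight (F : FrobSym) : ℕ :=
  F.top.length + F.top.sum + (F.bot.map Prod.fst).sum

/-- The number of non-overlined parts in the bottom row. -/
def botNonOverlined (F : FrobSym) : ℕ := (F.bot.filter fun p => !p.2).length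

/-- The number of overlined parts in the bottom row. -/
def botOverlined (F : FrobSym) : ℕ := (F.bot.filter fun p => p.2).length

/-- The `m`-th successive rank (0-based): `a_m - b_m` minus the number of
non-overlined parts among `b_{m+1}, …, b_N`. -/
def frobRank (F : FrobSym) (m : ℕ) : ℤ :=
  (F.top.getD m 0 : ℤ) - ((F.bot.getD m (0, false)).1 : ℤ) -
    (((F.bot.drop (m + 1)).filter fun p => !p.2).length : ℤ)

/-- All successive ranks lie in the interval `[-i+2, 2k-i-1]`. -/
def RankCond (k i : ℕ) (F : FrobSym) : Prop :=
  ∀ m : ℕ, m < F.top.length →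
    -(i : ℤ) + 2 ≤ frobRank F m ∧ frobRank F m ≤ 2 * (k : ℤ) - i - 1

/-- `Cbar k i n j` : the number of overpartitions of `n` (counted through their
Frobenius representation) with `j` non-overlined parts in the bottom row and all
successive ranks in `[-i+2, 2k-i-1]`. -/
noncomputable def Cbar (k i n j : ℕ) : ℕ :=
  Nat.card {F : FrobSym //
    frobWeight F = n ∧ botNonOverlined F = j ∧ RankCond k i F}

/-- The list of overlined parts (in order). -/
def olList (l : List (ℕ × Bool)) : List ℕ := (l.filter fun p => p.2).map Prod.fst

/-- The list of non-overlined parts (in order). -/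
def nolList (l : List (ℕ × Bool)) : List ℕ := (l.filter fun p => !p.2).map Prod.fst

/-- The size of the generalized Durfee square: the largest `N` such that the number of
overlined parts plus the number of non-overlined parts `≥ N` is at least `N`. -/
noncomputable def genDurfeeSize (l : List (ℕ × Bool)) : ℕ :=
  Nat.findGreatest
    (fun N => N ≤ (olList l).length + ((nolList l).filter fun p => decide (N ≤ p)).length)
    l.length

/-- The size of the generalized Durfee rectangle: the largest `N` such that the number
of overlined parts plus the number of non-overlined parts `≥ N + 1` is at least `N`. -/
noncomputable def genDurfeeRectSize (l : List (ℕ × Bool)) : ℕ :=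
  Nat.findGreatest
    (fun N => N ≤ (olList l).length + ((nolList l).filter fun p => decide (N + 1 ≤ p)).length)
    l.length

/-- The (ordinary) partition lying below the first generalized Durfee square/rectangle
of size `N`, when the overlined parts are displayed above the non-overlined ones. -/
def belowGen (l : List (ℕ × Bool)) (N : ℕ) : List ℕ :=
  (nolList l).drop (N - (olList l).length)

/-- The size of the Durfee square of an ordinary partition. -/
noncomputable def durfeeSquareSize (μ : List ℕ) : ℕ :=
  Nat.findGreatest (fun d => d ≤ (μ.filter fun p => decide (d ≤ p)).length) μ.length

/-- The size of the `d × (d+1)` Durfee rectangle of an ordinary partition. -/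
noncomputable def durfeeRectSize (μ : List ℕ) : ℕ :=
  Nat.findGreatest (fun d => d ≤ (μ.filter fun p => decide (d + 1 ≤ p)).length) μ.length

/-- Remove `m` successive Durfee squares. -/
noncomputable def dissectSquares : ℕ → List ℕ → List ℕ
  | 0, μ => μ
  | m + 1, μ => dissectSquares m (μ.drop (durfeeSquareSize μ))

/-- Remove `m` successive Durfee rectangles. -/
noncomputable def dissectRects : ℕ → List ℕ → List ℕ
  | 0, μ => μ
  | m + 1, μ => dissectRects m (μ.drop (durfeeRectSize μ))

/-- The overpartition has `i - 1` successive Durfee squares followed by `k - i`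
successive Durfee rectangles, the first one being a generalized
Durfee square (if `i ≥ 2`) or a generalized Durfee rectangle (if `i = 1`). -/
noncomputable def DurfeeCond (k i : ℕ) (l : List (ℕ × Bool)) : Prop :=
  if 2 ≤ i then
    dissectRects (k - i) (dissectSquares (i - 2) (belowGen l (genDurfeeSize l))) = []
  else
    dissectRects (k - 2) (belowGen l (genDurfeeRectSize l)) = []

/-- `Dbar k i n j` : the number of overpartitions of `n` with `j` overlined parts and
`i-1` successive Durfee squares followed by `k-i` successive Durfee rectangles, the
first one being a generalized Durfee square/rectangle. -/
noncomputable def Dbar (k i n j : ℕ) : ℕ :=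
  Nat.card {l : List (ℕ × Bool) //
    IsOverpartition l ∧ opWeight l = n ∧ opOverlined l = j ∧ DurfeeCond k i l}


open scoped Classical

section GeneratingFunctions

/-- Transfer of a sum along a bijection between sets. -/
lemma hasSum_of_bijOn {α β : Type*} {s : Set α} {t : Set β} {φ : α → β} {v : α → ℂ} {w : β → ℂ}
    {S : ℂ} (hφ : Set.BijOn φ s t) (hvw : ∀ x ∈ s, w (φ x) = v x) :
    HasSum (fun x : s => v x) S ↔ HasSum (fun y : t => w y) S := by
  rw [← (hφ.equiv φ).hasSum_iff]
  exact iff_of_eq (congrArg (fun f => HasSum f S) (funext fun x => (hvw x x.2).symm))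

/-- The product of two convergent complex series. -/
lemma hasSum_mul {α β : Type*} {v : α → ℂ} {w : β → ℂ} {S T : ℂ}
    (hv : HasSum v S) (hw : HasSum w T) :
    HasSum (fun z : α × β => v z.1 * w z.2) (S * T) := by
  have hv' := hv.summable.norm
  have hw' := hw.summable.norm
  have hsum : Summable fun z : α × β => v z.1 * w z.2 := summable_mul_of_summable_norm hv' hw'
  exact hv.mul hw hsum

/-- The product of two convergent complex series, as a sum over a product of sets. -/
lemma hasSum_prod_mul {α β : Type*} {s : Set α} {t : Set β} {v : α → ℂ} {w : β → ℂ} {S T : ℂ}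
    (hv : HasSum (fun x : s => v x) S) (hw : HasSum (fun y : t => w y) T) :
    HasSum (fun z : ↥(s ×ˢ t) => v z.1.1 * w z.1.2) (S * T) := by
  have h := hasSum_mul hv hw
  rw [← (Equiv.Set.prod s t).hasSum_iff] at h
  exact h

lemma hasSum_univ_geometric {x : ℂ} (hx : ‖x‖ < 1) (r : ℂ) :
    HasSum (fun c : (Set.univ : Set ℕ) => r * x ^ (c : ℕ)) (r * (1 - x)⁻¹) := by
  rw [← (Equiv.Set.univ ℕ).symm.hasSum_iff]
  have h := (hasSum_geometric_of_norm_lt_one hx).mul_left r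
  exact h

/-- If every element of `s` arises uniquely from an element of `t` and a natural number `c`
which contributes a factor `r * x ^ c`, the sum over `s` is `r / (1 - x)` times that over `t`. -/
lemma hasSum_of_bijOn_geometric {α β : Type*} {s : Set α} {t : Set β} {φ : ℕ × β → α}
    {w : α → ℂ} {v : β → ℂ} {r x S : ℂ} (hx : ‖x‖ < 1)
    (hφ : Set.BijOn φ (Set.univ ×ˢ t) s)
    (hw : ∀ c, ∀ b ∈ t, w (φ (c, b)) = r * x ^ c * v b)
    (hv : HasSum (fun b : t => v b) S) :
    HasSum (fun l : s => w l) (r * (1 - x)⁻¹ * S) := by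
  have hvw : ∀ z ∈ (Set.univ ×ˢ t : Set (ℕ × β)), w (φ z) = r * x ^ z.1 * v z.2 :=
    fun z hz => hw z.1 z.2 hz.2
  rw [← hasSum_of_bijOn hφ hvw]
  exact hasSum_prod_mul (s := Set.univ) (t := t) (v := fun c : ℕ => r * x ^ c) (w := v)
    (hasSum_univ_geometric hx r) hv

/-- Non-increasing lists of `k` integers, all at least `N`. -/
def descLists (N k : ℕ) : Set (List ℕ) :=
  {l | l.Pairwise (· ≥ ·) ∧ (∀ x ∈ l, N ≤ x) ∧ l.length = k}

/-- Strictly decreasing lists of `m` positive integers. -/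
def strictLists (m : ℕ) : Set (List ℕ) :=
  {l | l.Pairwise (· > ·) ∧ (∀ x ∈ l, 1 ≤ x) ∧ l.length = m}

/-- Non-increasing lists of integers between `1` and `N`. -/
def boundedLists (N : ℕ) : Set (List ℕ) :=
  {l | l.Pairwise (· ≥ ·) ∧ ∀ x ∈ l, 1 ≤ x ∧ x ≤ N}

lemma sum_map_add (l : List ℕ) (c : ℕ) : (l.map (· + c)).sum = l.sum + l.length * c := by
  induction l with
  | nil => simp
  | cons x l ih => simp [ih]; ring

lemma map_sub_add {l : List ℕ} {c : ℕ} (h : ∀ x ∈ l, c ≤ x) :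
    (l.map (· - c)).map (· + c) = l := by
  rw [List.map_map]
  conv_rhs => rw [← List.map_id l]
  exact List.map_congr_left fun x hx => Nat.sub_add_cancel (h x hx)

lemma bijOn_descLists_succ (N k : ℕ) :
    Set.BijOn (fun z : ℕ × List ℕ => z.2.map (· + z.1) ++ [N + z.1])
      (Set.univ ×ˢ descLists N k) (descLists N (k + 1)) := by
  refine ⟨?_, ?_, ?_⟩
  · rintro ⟨c, l⟩ ⟨-, hp, hN, hk⟩
    refine ⟨?_, ?_, by simpa using hk⟩
    · simp only [List.pairwise_append, List.pairwise_map]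
      refine ⟨hp.imp fun h => by simpa using h, by simp, ?_⟩
      simpa using hN
    · simp only [List.mem_append, List.mem_map, List.mem_singleton]
      rintro x (⟨y, hy, rfl⟩ | rfl)
      · exact (hN y hy).trans (Nat.le_add_right _ _)
      · exact Nat.le_add_right _ _
  · rintro ⟨c, l⟩ - ⟨c', l'⟩ - h
    obtain ⟨h₁, h₂⟩ := List.append_inj' h rfl
    obtain rfl : c = c' := by simpa using h₂
    exact Prod.ext rfl (List.map_injective_iff.mpr (add_left_injective c) h₁)
  · rintro l ⟨hp, hN, hk⟩
    obtain ⟨l, c, rfl⟩ := (List.eq_nil_or_concat l).resolve_left (by rintro rfl; simp at hk)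
    rw [List.concat_eq_append] at *
    rw [List.pairwise_append] at hp
    have hc : N ≤ c := hN c (by simp)
    have hl : ∀ x ∈ l, c ≤ x := fun x hx => hp.2.2 x hx c (by simp)
    refine ⟨(c - N, l.map (· - (c - N))), ⟨trivial, ?_, ?_, by simpa using hk⟩, ?_⟩
    · rw [List.pairwise_map]
      exact hp.1.imp fun h => Nat.sub_le_sub_right h _
    · simp only [List.mem_map]
      rintro x ⟨y, hy, rfl⟩
      have := hl y hy
      omega
    · simp only [Nat.add_sub_cancel' hc]
      rw [map_sub_add fun x hx => (Nat.sub_le c N).trans (hl x hx)]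

lemma bijOn_strictLists_succ (m : ℕ) :
    Set.BijOn (fun z : ℕ × List ℕ => z.2.map (· + (z.1 + 1)) ++ [z.1 + 1])
      (Set.univ ×ˢ strictLists m) (strictLists (m + 1)) := by
  refine ⟨?_, ?_, ?_⟩
  · rintro ⟨c, l⟩ ⟨-, hp, h1, hk⟩
    refine ⟨?_, ?_, by simpa using hk⟩
    · simp only [List.pairwise_append, List.pairwise_map]
      refine ⟨hp.imp fun h => by simpa using h, by simp, ?_⟩
      simp only [List.mem_map, List.mem_singleton]
      rintro x ⟨y, hy, rfl⟩ z rfl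
      have : 1 ≤ y := h1 y hy
      omega
    · simp only [List.mem_append, List.mem_map, List.mem_singleton]
      rintro x (⟨y, hy, rfl⟩ | rfl) <;> omega
  · rintro ⟨c, l⟩ - ⟨c', l'⟩ - h
    obtain ⟨h₁, h₂⟩ := List.append_inj' h rfl
    obtain rfl : c = c' := by simpa using h₂
    exact Prod.ext rfl (List.map_injective_iff.mpr (add_left_injective (c + 1)) h₁)
  · rintro l ⟨hp, h1, hk⟩
    obtain ⟨l, c, rfl⟩ := (List.eq_nil_or_concat l).resolve_left (by rintro rfl; simp at hk)
    rw [List.concat_eq_append] at *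
    rw [List.pairwise_append] at hp
    have hc : 1 ≤ c := h1 c (by simp)
    obtain ⟨c, rfl⟩ := Nat.exists_eq_add_of_le' hc
    have hl : ∀ x ∈ l, c + 1 < x := fun x hx => hp.2.2 x hx (c + 1) (by simp)
    refine ⟨(c, l.map (· - (c + 1))), ⟨trivial, ?_, ?_, by simpa using hk⟩, ?_⟩
    · rw [List.pairwise_map]
      refine hp.1.imp_of_mem fun {x y} hx hy h => ?_
      have := hl y hy
      have : y < x := h
      show y - (c + 1) < x - (c + 1)
      omega
    · simp only [List.mem_map]
      rintro x ⟨y, hy, rfl⟩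
      have := hl y hy
      omega
    · simp only
      rw [map_sub_add fun x hx => (hl x hx).le]

lemma bijOn_boundedLists_succ (N : ℕ) :
    Set.BijOn (fun z : ℕ × List ℕ => List.replicate z.1 (N + 1) ++ z.2)
      (Set.univ ×ˢ boundedLists N) (boundedLists (N + 1)) := by
  have hcount : ∀ l ∈ boundedLists N, l.count (N + 1) = 0 := fun l hl =>
    List.count_eq_zero.mpr fun h => by have := (hl.2 _ h).2; omega
  refine ⟨?_, ?_, ?_⟩
  · rintro ⟨c, l⟩ ⟨-, hp, h1⟩
    refine ⟨?_, ?_⟩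
    · simp only [List.pairwise_append, List.pairwise_replicate, List.mem_replicate]
      refine ⟨by simp, hp, ?_⟩
      rintro x ⟨-, rfl⟩ y hy
      exact (h1 y hy).2.trans (Nat.le_succ N)
    · simp only [List.mem_append, List.mem_replicate]
      rintro x (⟨-, rfl⟩ | hx)
      · omega
      · have := h1 x hx
        omega
  · rintro ⟨c, l⟩ ⟨-, hl⟩ ⟨c', l'⟩ ⟨-, hl'⟩ h
    have hc := congrArg (List.count (N + 1)) h
    simp only [List.count_append, List.count_replicate_self, hcount l hl, hcount l' hl',
      add_zero] at hc
    subst hc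
    exact Prod.ext rfl (List.append_cancel_left h)
  · rintro l ⟨hp, h1⟩
    induction l with
    | nil => exact ⟨(0, []), ⟨trivial, by simp [boundedLists]⟩, by simp⟩
    | cons x l ih =>
      rw [List.pairwise_cons] at hp
      by_cases hx : x = N + 1
      · obtain ⟨⟨c, l'⟩, h, rfl⟩ := ih hp.2 fun y hy => h1 y (List.mem_cons_of_mem _ hy)
        exact ⟨(c + 1, l'), h, by simp [hx, List.replicate_succ]⟩
      · have hxN := h1 x (by simp)
        refine ⟨(0, x :: l), ⟨trivial, List.pairwise_cons.mpr hp, fun y hy => ?_⟩, by simp⟩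
        have hy1 := h1 y hy
        rcases List.mem_cons.mp hy with rfl | hy
        · omega
        · have : y ≤ x := hp.1 y hy
          omega

lemma hasSum_singleton_nil {s : Set (List ℕ)} (hs : s = {[]}) (q : ℂ) :
    HasSum (fun l : s => q ^ (l : List ℕ).sum) 1 := by
  subst hs
  simpa using hasSum_unique (fun l : ({[]} : Set (List ℕ)) => q ^ (l : List ℕ).sum)

lemma qPochN_self_succ (q : ℂ) (k : ℕ) :
    qPochN q q (k + 1) = qPochN q q k * (1 - q ^ (k + 1)) := by
  rw [qPochN, Finset.prod_range_succ, ← qPochN, pow_succ']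

variable {q : ℂ}

lemma norm_pow_succ_lt_one (hq : ‖q‖ < 1) (k : ℕ) : ‖q ^ (k + 1)‖ < 1 := by
  rw [norm_pow]
  exact pow_lt_one₀ (norm_nonneg q) hq k.succ_ne_zero

lemma one_sub_pow_succ_ne_zero (hq : ‖q‖ < 1) (k : ℕ) : 1 - q ^ (k + 1) ≠ 0 := by
  intro h
  have := norm_pow_succ_lt_one hq k
  rw [← sub_eq_zero.mp h, norm_one] at this
  exact this.false

lemma qPochN_self_ne_zero (hq : ‖q‖ < 1) (k : ℕ) : qPochN q q k ≠ 0 := by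
  induction k with
  | zero => simp [qPochN]
  | succ k ih => rw [qPochN_self_succ]; exact mul_ne_zero ih (one_sub_pow_succ_ne_zero hq k)

lemma hasSum_descLists (hq : ‖q‖ < 1) (N k : ℕ) :
    HasSum (fun l : descLists N k => q ^ (l : List ℕ).sum) (q ^ (N * k) / qPochN q q k) := by
  induction k with
  | zero =>
    have hs : descLists N 0 = {[]} := by
      ext l
      simp only [descLists, List.length_eq_zero_iff, Set.mem_ofPred_eq, Set.mem_singleton_iff]
      exact ⟨fun h => h.2.2, by rintro rfl; simp⟩
    simpa [qPochN] using hasSum_singleton_nil hs q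
  | succ k ih =>
    have hw : ∀ c, ∀ l ∈ descLists N k, q ^ (l.map (· + c) ++ [N + c]).sum =
        q ^ N * (q ^ (k + 1)) ^ c * q ^ l.sum := fun c l hl => by
      rw [List.sum_append, sum_map_add, List.sum_singleton, hl.2.2, ← pow_mul, ← pow_add,
        ← pow_add]
      congr 1
      ring
    have h := hasSum_of_bijOn_geometric (w := fun l : List ℕ => q ^ l.sum)
      (v := fun l : List ℕ => q ^ l.sum) (norm_pow_succ_lt_one hq k)
      (bijOn_descLists_succ N k) hw ih
    convert h using 1
    rw [qPochN_self_succ, div_eq_mul_inv, div_eq_mul_inv, mul_inv]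
    ring

lemma hasSum_strictLists (hq : ‖q‖ < 1) (m : ℕ) :
    HasSum (fun l : strictLists m => q ^ (l : List ℕ).sum)
      (q ^ ((m + 1).choose 2) / qPochN q q m) := by
  induction m with
  | zero =>
    have hs : strictLists 0 = {[]} := by
      ext l
      simp only [strictLists, List.length_eq_zero_iff, Set.mem_ofPred_eq, Set.mem_singleton_iff]
      exact ⟨fun h => h.2.2, by rintro rfl; simp⟩
    simpa [qPochN] using hasSum_singleton_nil hs q
  | succ m ih =>
    have hw : ∀ c, ∀ l ∈ strictLists m, q ^ (l.map (· + (c + 1)) ++ [c + 1]).sum =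
        q ^ (m + 1) * (q ^ (m + 1)) ^ c * q ^ l.sum := fun c l hl => by
      rw [List.sum_append, sum_map_add, List.sum_singleton, hl.2.2, ← pow_mul, ← pow_add,
        ← pow_add]
      congr 1
      ring
    have h := hasSum_of_bijOn_geometric (w := fun l : List ℕ => q ^ l.sum)
      (v := fun l : List ℕ => q ^ l.sum) (norm_pow_succ_lt_one hq m)
      (bijOn_strictLists_succ m) hw ih
    convert h using 1
    rw [qPochN_self_succ, Nat.choose_succ_succ' (m + 1) 1, Nat.choose_one_right,
      div_eq_mul_inv, div_eq_mul_inv, mul_inv]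
    ring

lemma hasSum_boundedLists (hq : ‖q‖ < 1) (N : ℕ) :
    HasSum (fun l : boundedLists N => q ^ (l : List ℕ).sum) (1 / qPochN q q N) := by
  induction N with
  | zero =>
    have hs : boundedLists 0 = {[]} := by
      ext l
      simp only [boundedLists, Set.mem_ofPred_eq, Set.mem_singleton_iff]
      refine ⟨fun h => List.eq_nil_iff_forall_not_mem.mpr fun x hx => ?_, by rintro rfl; simp⟩
      have := h.2 x hx
      omega
    simpa [qPochN] using hasSum_singleton_nil hs q
  | succ N ih =>
    have hw : ∀ c, ∀ l ∈ boundedLists N, q ^ (List.replicate c (N + 1) ++ l).sum =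
        1 * (q ^ (N + 1)) ^ c * q ^ l.sum := fun c l _ => by
      rw [List.sum_append, List.sum_replicate, smul_eq_mul, one_mul, ← pow_mul, ← pow_add,
        mul_comm c]
    have h := hasSum_of_bijOn_geometric (w := fun l : List ℕ => q ^ l.sum)
      (v := fun l : List ℕ => q ^ l.sum) (norm_pow_succ_lt_one hq N)
      (bijOn_boundedLists_succ N) hw ih
    convert h using 1
    rw [qPochN_self_succ, div_eq_mul_inv, div_eq_mul_inv, mul_inv]
    ring

/-- The finite `q`-binomial theorem, divided by `(q;q)_N`. -/
lemma sum_antidiagonal_qBinomial (hq : ‖q‖ < 1) (a : ℂ) (N : ℕ) :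
    ∑ p ∈ Finset.HasAntidiagonal.antidiagonal N,
        a ^ p.1 * q ^ (p.2.choose 2) / (qPochN q q p.1 * qPochN q q p.2) =
      (∏ i ∈ Finset.range N, (a + q ^ i)) / qPochN q q N := by
  induction N with
  | zero => simp [qPochN]
  | succ N ih =>
    set g : ℕ × ℕ → ℂ := fun p =>
      a ^ p.1 * q ^ (p.2.choose 2) / (qPochN q q p.1 * qPochN q q p.2) with hg
    have hsplit : (1 - q ^ (N + 1)) * ∑ p ∈ Finset.HasAntidiagonal.antidiagonal (N + 1), g p =
        ∑ p ∈ Finset.HasAntidiagonal.antidiagonal (N + 1), (1 - q ^ p.1) * g p +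
          ∑ p ∈ Finset.HasAntidiagonal.antidiagonal (N + 1), q ^ p.1 * (1 - q ^ p.2) * g p := by
      rw [Finset.mul_sum, ← Finset.sum_add_distrib]
      refine Finset.sum_congr rfl fun p hp => ?_
      rw [← Finset.HasAntidiagonal.mem_antidiagonal.mp hp, pow_add]
      ring
    have hleft : ∑ p ∈ Finset.HasAntidiagonal.antidiagonal (N + 1), (1 - q ^ p.1) * g p =
        a * ∑ p ∈ Finset.HasAntidiagonal.antidiagonal N, g p := by
      rw [Finset.Nat.sum_antidiagonal_succ, Finset.mul_sum]
      simp only [pow_zero, sub_self, zero_mul, zero_add]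
      refine Finset.sum_congr rfl fun p _ => ?_
      have h₁ := qPochN_self_ne_zero hq p.1
      have h₂ := qPochN_self_ne_zero hq p.2
      have h₃ := one_sub_pow_succ_ne_zero hq p.1
      simp only [hg, qPochN_self_succ]
      field_simp
      ring
    have hright : ∑ p ∈ Finset.HasAntidiagonal.antidiagonal (N + 1), q ^ p.1 * (1 - q ^ p.2) * g p =
        q ^ N * ∑ p ∈ Finset.HasAntidiagonal.antidiagonal N, g p := by
      rw [Finset.Nat.sum_antidiagonal_succ', Finset.mul_sum]
      simp only [pow_zero, sub_self, mul_zero, zero_mul, zero_add]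
      refine Finset.sum_congr rfl fun p hp => ?_
      have h₁ := qPochN_self_ne_zero hq p.1
      have h₂ := qPochN_self_ne_zero hq p.2
      have h₃ := one_sub_pow_succ_ne_zero hq p.2
      simp only [hg, qPochN_self_succ]
      rw [← Finset.HasAntidiagonal.mem_antidiagonal.mp hp, Nat.choose_succ_succ' p.2 1,
        Nat.choose_one_right]
      field_simp
      ring
    rw [hleft, hright, ← add_mul, ih] at hsplit
    have h₁ := qPochN_self_ne_zero hq N
    have h₃ := one_sub_pow_succ_ne_zero hq N
    rw [Finset.prod_range_succ, qPochN_self_succ]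
    refine mul_left_cancel₀ h₃ (hsplit.trans ?_)
    field_simp

end GeneratingFunctions

section Overpartitions

/-- The condition on consecutive parts of an overpartition is transitive, so it holds for all pairs
of parts. -/
lemma isOverpartition_iff (l : List (ℕ × Bool)) :
    IsOverpartition l ↔ (∀ p ∈ l, 1 ≤ p.1) ∧
      l.Pairwise fun x y => y.1 < x.1 ∨ (x.1 = y.1 ∧ x.2 = false) := by
  have : IsTrans (ℕ × Bool) fun x y => y.1 < x.1 ∨ (x.1 = y.1 ∧ x.2 = false) :=
    ⟨fun x y z => by
      rintro (h | ⟨h, h'⟩) (k | ⟨k, k'⟩)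
      · exact Or.inl (k.trans h)
      · exact Or.inl (k ▸ h)
      · exact Or.inl (h ▸ k)
      · exact Or.inr ⟨h.trans k, h'⟩⟩
  exact and_congr_right fun _ => List.isChain_iff_pairwise

lemma map_olList (l : List (ℕ × Bool)) :
    (olList l).map (fun n => (n, true)) = l.filter fun p => p.2 := by
  rw [olList, List.map_map]
  conv_rhs => rw [← List.map_id (l.filter fun p => p.2)]
  refine List.map_congr_left fun p hp => Prod.ext rfl ?_
  simpa using (List.of_mem_filter hp).symm

lemma map_nolList (l : List (ℕ × Bool)) :
    (nolList l).map (fun n => (n, false)) = l.filter fun p => !p.2 := by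
  rw [nolList, List.map_map]
  conv_rhs => rw [← List.map_id (l.filter fun p => !p.2)]
  refine List.map_congr_left fun p hp => Prod.ext rfl ?_
  have := List.of_mem_filter hp
  simpa using this

lemma perm_olList_append_nolList (l : List (ℕ × Bool)) :
    ((olList l).map (fun n => (n, true)) ++ (nolList l).map fun n => (n, false)).Perm l := by
  rw [map_olList, map_nolList]
  exact List.filter_append_perm (fun p => p.2) l

lemma opWeight_eq (l : List (ℕ × Bool)) : opWeight l = (olList l).sum + (nolList l).sum := by
  rw [opWeight, ← ((perm_olList_append_nolList l).map Prod.fst).sum_eq]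
  simp [Function.comp_def]

lemma length_eq (l : List (ℕ × Bool)) : l.length = (olList l).length + (nolList l).length := by
  rw [← (perm_olList_append_nolList l).length_eq]
  simp

lemma opOverlined_eq (l : List (ℕ × Bool)) : opOverlined l = (olList l).length := by
  rw [opOverlined, olList, List.length_map]

lemma mem_olList {l : List (ℕ × Bool)} {n : ℕ} : n ∈ olList l ↔ (n, true) ∈ l := by
  simp [olList]

lemma mem_nolList {l : List (ℕ × Bool)} {n : ℕ} : n ∈ nolList l ↔ (n, false) ∈ l := by
  simp [nolList]

lemma IsOverpartition.pairwise_olList {l : List (ℕ × Bool)} (h : IsOverpartition l) :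
    (olList l).Pairwise (· > ·) := by
  rw [olList, List.pairwise_map]
  refine (((isOverpartition_iff l).mp h).2.filter _).imp_of_mem fun {x y} hx _ hxy => ?_
  have := List.of_mem_filter hx
  rcases hxy with h | h
  · exact h
  · simp_all

lemma IsOverpartition.pairwise_nolList {l : List (ℕ × Bool)} (h : IsOverpartition l) :
    (nolList l).Pairwise (· ≥ ·) := by
  rw [nolList, List.pairwise_map]
  refine (((isOverpartition_iff l).mp h).2.filter _).imp fun {x y} hxy => ?_
  rcases hxy with h | h
  · exact h.le
  · exact h.1.ge

lemma IsOverpartition.eq_of_lists_eq {l l' : List (ℕ × Bool)} (h : IsOverpartition l)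
    (h' : IsOverpartition l') (ho : olList l = olList l') (hn : nolList l = nolList l') :
    l = l' := by
  have hperm : l.Perm l' := by
    have := (perm_olList_append_nolList l).symm
    rw [ho, hn] at this
    exact this.trans (perm_olList_append_nolList l')
  refine hperm.eq_of_pairwise (fun x y _ _ hxy hyx => ?_)
    ((isOverpartition_iff l).mp h).2 ((isOverpartition_iff l').mp h').2
  rcases hxy with hxy | hxy <;> rcases hyx with hyx | hyx
  · omega
  · omega
  · omega
  · exact Prod.ext hxy.1 (hxy.2.trans hyx.2.symm)

/-- Any strictly decreasing list and any non-increasing list of positive integers are the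
overlined and non-overlined parts of an overpartition. -/
lemma exists_overpartition {d s : List ℕ} (hd : d.Pairwise (· > ·)) (hd1 : ∀ x ∈ d, 1 ≤ x)
    (hs : s.Pairwise (· ≥ ·)) (hs1 : ∀ x ∈ s, 1 ≤ x) :
    ∃ l, IsOverpartition l ∧ olList l = d ∧ nolList l = s := by
  set u : List (ℕ × Bool) := d.map (fun n => (n, true)) ++ s.map fun n => (n, false) with hu
  let le : ℕ × Bool → ℕ × Bool → Bool :=
    fun x y => decide (y.1 < x.1 ∨ (x.1 = y.1 ∧ (x.2 = false ∨ y.2 = true)))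
  have hperm : (u.mergeSort le).Perm u := List.mergeSort_perm u le
  have hsorted : (u.mergeSort le).Pairwise fun x y => le x y = true := by
    refine List.pairwise_mergeSort (fun x y z => ?_) (fun x y => ?_) u
    · simp only [le, decide_eq_true_eq]
      grind
    · simp only [le, Bool.or_eq_true, decide_eq_true_eq]
      grind
  have hdistinct : (u.mergeSort le).Pairwise fun x y => ¬(x = y ∧ x.2 = true) := by
    have hsymm : ∀ {x y : ℕ × Bool}, ¬(x = y ∧ x.2 = true) → ¬(y = x ∧ y.2 = true) :=
      fun h h' => h ⟨h'.1.symm, h'.1 ▸ h'.2⟩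
    rw [hperm.pairwise_iff hsymm, hu,
      List.pairwise_append, List.pairwise_map, List.pairwise_map]
    refine ⟨hd.imp fun h h' => ?_, hs.imp fun _ h' => by simp at h', ?_⟩
    · have := congrArg Prod.fst h'.1
      simp only at this
      omega
    · simp only [List.mem_map]
      rintro _ ⟨x, _, rfl⟩ _ ⟨y, _, rfl⟩ h
      simp at h
  have hover : IsOverpartition (u.mergeSort le) := by
    rw [isOverpartition_iff]
    refine ⟨fun p hp => ?_, (hsorted.and hdistinct).imp fun {x y} h => ?_⟩
    · rw [hperm.mem_iff, hu, List.mem_append, List.mem_map, List.mem_map] at hp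
      rcases hp with ⟨x, hx, rfl⟩ | ⟨x, hx, rfl⟩
      · exact hd1 x hx
      · exact hs1 x hx
    · obtain ⟨h₁, h₂⟩ := h
      simp only [le, decide_eq_true_eq] at h₁
      grind
  have hol : (olList (u.mergeSort le)).Perm d := by
    have := (hperm.filter fun p => p.2).map Prod.fst
    simpa [hu, olList, List.filter_map, Function.comp_def] using this
  have hnol : (nolList (u.mergeSort le)).Perm s := by
    have := (hperm.filter fun p => !p.2).map Prod.fst
    simpa [hu, nolList, List.filter_map, Function.comp_def] using this
  refine ⟨u.mergeSort le, hover, ?_, ?_⟩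
  · exact hol.eq_of_pairwise (fun _ _ _ _ h h' => absurd h (lt_asymm h'))
      hover.pairwise_olList hd
  · exact hnol.eq_of_pairwise (fun _ _ _ _ h h' => le_antisymm h' h)
      hover.pairwise_nolList hs

lemma olList_length_le_genDurfeeSize (l : List (ℕ × Bool)) :
    (olList l).length ≤ genDurfeeSize l :=
  Nat.le_findGreatest (length_eq l ▸ Nat.le_add_right _ _) (Nat.le_add_right _ _)

/-- Splitting the non-overlined parts after the first `N - m` of them, where `m` is the number of
overlined parts, detects whether the generalized Durfee square has size `N`. -/
lemma genDurfeeSize_eq_iff {l : List (ℕ × Bool)} {A B : List ℕ} {m k : ℕ}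
    (hm : (olList l).length = m) (hAB : nolList l = A ++ B) (hA : A.length = k)
    (hsorted : ∀ x ∈ A, ∀ y ∈ B, y ≤ x) :
    genDurfeeSize l = m + k ↔ (∀ x ∈ A, m + k ≤ x) ∧ ∀ x ∈ B, x ≤ m + k := by
  have hlen := length_eq l
  rw [hm, hAB, List.length_append, hA] at hlen
  simp only [genDurfeeSize, Nat.findGreatest_eq_iff, hm, hAB, List.filter_append,
    List.length_append]
  constructor
  · rintro ⟨-, h, h'⟩
    constructor
    · intro x hx
      by_contra! hlt
      have hB : B.filter (fun p => decide (m + k ≤ p)) = [] :=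
        List.filter_eq_nil_iff.mpr fun y hy => by
          have := hsorted x hx y hy
          simp only [decide_eq_true_eq]
          omega
      have hA' : (A.filter fun p => decide (m + k ≤ p)).length < A.length :=
        List.length_filter_lt_length_iff_exists.mpr ⟨x, hx, by simpa using hlt⟩
      have := h (by omega)
      rw [hB, List.length_nil] at this
      omega
    · intro x hx
      by_contra! hlt
      have hA' : A.filter (fun p => decide (m + k + 1 ≤ p)) = A :=
        List.filter_eq_self.mpr fun y hy => by
          have := hsorted y hy x hx
          simp only [decide_eq_true_eq]
          omega
      have hB : 0 < (B.filter fun p => decide (m + k + 1 ≤ p)).length :=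
        List.length_pos_of_mem (List.mem_filter.mpr ⟨hx, by simpa using hlt⟩)
      have hB' : 0 < B.length := List.length_pos_of_mem hx
      refine h' (Nat.lt_succ_self (m + k)) (by omega) ?_
      rw [Nat.succ_eq_add_one, hA']
      omega
  · rintro ⟨hAN, hBN⟩
    refine ⟨by omega, fun _ => ?_, fun M hM _ => ?_⟩
    · have : A.filter (fun p => decide (m + k ≤ p)) = A :=
        List.filter_eq_self.mpr fun y hy => by simpa using hAN y hy
      rw [this]
      omega
    · have hB : B.filter (fun p => decide (M ≤ p)) = [] :=
        List.filter_eq_nil_iff.mpr fun y hy => by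
          have := hBN y hy
          simp only [decide_eq_true_eq]
          omega
      have := List.length_filter_le (fun p => decide (M ≤ p)) A
      rw [hB, List.length_nil]
      omega

lemma le_nolList_length {l : List (ℕ × Bool)} {m k : ℕ} (hm : (olList l).length = m)
    (h : genDurfeeSize l = m + k) : k ≤ (nolList l).length := by
  have hle : genDurfeeSize l ≤ l.length := Nat.findGreatest_le _
  rw [h, length_eq, hm] at hle
  omega

/-- Overpartitions with `m` overlined parts and generalized Durfee square of size `m + k`. -/
def durfeeOverpartitions (m k : ℕ) : Set (List (ℕ × Bool)) :=
  {l | IsOverpartition l ∧ (olList l).length = m ∧ genDurfeeSize l = m + k}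

lemma bijOn_durfeeOverpartitions (m k : ℕ) :
    Set.BijOn (fun l => (olList l, (nolList l).take k, (nolList l).drop k))
      (durfeeOverpartitions m k)
      (strictLists m ×ˢ (descLists (m + k) k ×ˢ boundedLists (m + k))) := by
  refine ⟨?_, ?_, ?_⟩
  · rintro l ⟨h, hm, hN⟩
    have hp := h.pairwise_nolList
    have hk := le_nolList_length hm hN
    have hlen : ((nolList l).take k).length = k := List.length_take_of_le hk
    rw [← List.take_append_drop k (nolList l), List.pairwise_append] at hp
    obtain ⟨hA, hB⟩ := (genDurfeeSize_eq_iff hm (List.take_append_drop k (nolList l)).symm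
      hlen hp.2.2).mp hN
    refine ⟨⟨h.pairwise_olList, fun x hx => h.1 _ (mem_olList.mp hx), hm⟩,
      ⟨hp.1, hA, hlen⟩, ⟨hp.2.1, fun x hx => ⟨?_, hB x hx⟩⟩⟩
    exact h.1 _ (mem_nolList.mp (List.mem_of_mem_drop hx))
  · rintro l ⟨h, -, -⟩ l' ⟨h', -, -⟩ heq
    simp only [Prod.mk.injEq] at heq
    refine h.eq_of_lists_eq h' heq.1 ?_
    rw [← List.take_append_drop k (nolList l), heq.2.1, heq.2.2, List.take_append_drop]
  · rintro ⟨d, A, B⟩ ⟨⟨hd, hd1, hm⟩, ⟨hA, hAN, hk⟩, ⟨hB, hBN⟩⟩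
    simp only at hd hd1 hm hA hAN hk hB hBN
    have hcross : ∀ x ∈ A, ∀ y ∈ B, y ≤ x := fun x hx y hy =>
      (hBN y hy).2.trans (hAN x hx)
    obtain ⟨l, hl, ho, hn⟩ := exists_overpartition (s := A ++ B) hd hd1
      (List.pairwise_append.mpr ⟨hA, hB, hcross⟩) (fun x hx => by
        rcases List.mem_append.mp hx with hx | hx
        · have := hAN x hx
          have := List.length_pos_of_mem hx
          omega
        · exact (hBN x hx).1)
    refine ⟨l, ⟨hl, ho ▸ hm, ?_⟩, ?_⟩
    · exact (genDurfeeSize_eq_iff (ho ▸ hm) hn hk hcross).mpr ⟨hAN, fun x hx => (hBN x hx).2⟩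
    · simp [ho, hn, ← hk]

lemma hasSum_durfeeOverpartitions {q : ℂ} (hq : ‖q‖ < 1) (a : ℂ) (m k : ℕ) :
    HasSum (fun l : durfeeOverpartitions m k =>
        q ^ opWeight (l : List (ℕ × Bool)) * a ^ opOverlined (l : List (ℕ × Bool)))
      (a ^ m * (q ^ ((m + 1).choose 2) / qPochN q q m *
        (q ^ ((m + k) * k) / qPochN q q k * (1 / qPochN q q (m + k))))) := by
  have hAB := hasSum_prod_mul (v := fun l : List ℕ => q ^ l.sum)
    (w := fun l : List ℕ => q ^ l.sum) (hasSum_descLists hq (m + k) k)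
    (hasSum_boundedLists hq (m + k))
  have hdAB := hasSum_prod_mul (v := fun l : List ℕ => q ^ l.sum)
    (w := fun z : List ℕ × List ℕ => q ^ z.1.sum * q ^ z.2.sum) (hasSum_strictLists hq m) hAB
  have hprod := hdAB.mul_left (a ^ m)
  have hweight : ∀ l ∈ durfeeOverpartitions m k,
      a ^ m * (q ^ (olList l).sum *
        (q ^ ((nolList l).take k).sum * q ^ ((nolList l).drop k).sum)) =
      q ^ opWeight l * a ^ opOverlined l := by
    rintro l ⟨-, hm, -⟩
    rw [opWeight_eq, opOverlined_eq, hm, ← List.sum_take_add_sum_drop (nolList l) k, pow_add,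
      pow_add]
    ring
  rw [hasSum_of_bijOn (v := fun l => q ^ opWeight l * a ^ opOverlined l)
    (w := fun z : List ℕ × List ℕ × List ℕ =>
      a ^ m * (q ^ z.1.sum * (q ^ z.2.1.sum * q ^ z.2.2.sum)))
    (bijOn_durfeeOverpartitions m k) hweight]
  exact hprod

lemma hasSum_genDurfeeSize_eq {q : ℂ} (hq : ‖q‖ < 1) (a : ℂ) (N : ℕ) :
    HasSum (fun l : {l : List (ℕ × Bool) | IsOverpartition l ∧ genDurfeeSize l = N} =>
        q ^ opWeight (l : List (ℕ × Bool)) * a ^ opOverlined (l : List (ℕ × Bool)))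
      (∑ p ∈ Finset.HasAntidiagonal.antidiagonal N,
        a ^ p.1 * (q ^ ((p.1 + 1).choose 2) / qPochN q q p.1 *
          (q ^ ((p.1 + p.2) * p.2) / qPochN q q p.2 * (1 / qPochN q q (p.1 + p.2))))) := by
  have hunion : {l : List (ℕ × Bool) | IsOverpartition l ∧ genDurfeeSize l = N} =
      ⋃ p ∈ Finset.HasAntidiagonal.antidiagonal N, durfeeOverpartitions p.1 p.2 := by
    ext l
    simp only [Set.mem_ofPred_eq, Set.mem_iUnion, Finset.HasAntidiagonal.mem_antidiagonal,
      exists_prop, durfeeOverpartitions]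
    constructor
    · rintro ⟨h, hN⟩
      have hle := hN ▸ olList_length_le_genDurfeeSize l
      exact ⟨((olList l).length, N - (olList l).length), Nat.add_sub_cancel' hle, h, rfl,
        hN.trans (Nat.add_sub_cancel' hle).symm⟩
    · rintro ⟨p, hp, h, -, hN⟩
      exact ⟨h, hN.trans hp⟩
  rw [hunion]
  refine hasSum_sum_disjoint (f := fun l => q ^ opWeight l * a ^ opOverlined l) _ ?_
    fun p _ => hasSum_durfeeOverpartitions hq a p.1 p.2
  intro p hp p' hp' hne
  refine Set.disjoint_left.mpr fun l hl hl' => hne ?_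
  have h₁ : p.1 = p'.1 := hl.2.1.symm.trans hl'.2.1
  have h₂ : p.1 + p.2 = p'.1 + p'.2 := hl.2.2.symm.trans hl'.2.2
  exact Prod.ext h₁ (by omega)

/-- A convergent weighted sum, collected according to the value of a statistic on which the
weight depends. -/
lemma hasSum_natCard_fiber {α β : Type*} {g : α → β} {w : β → ℂ} {S : ℂ}
    (h : HasSum (fun x => w (g x)) S) :
    HasSum (fun b => (Nat.card {x // g x = b} : ℂ) * w b) S := by
  have hs := (Equiv.sigmaFiberEquiv g).hasSum_iff.mpr h
  refine hs.sigma fun b => ?_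
  have hb : (fun c : {x // g x = b} =>
      ((fun x => w (g x)) ∘ Equiv.sigmaFiberEquiv g) ⟨b, c⟩) = fun _ => w b :=
    funext fun c => congrArg w c.2
  have hsum := (hs.summable.sigma_factor b).hasSum
  rw [hb] at hsum ⊢
  rwa [tsum_const, nsmul_eq_mul] at hsum

/-- The `q`-binomial theorem in the form produced by splitting off the generalized Durfee square. -/
lemma sum_antidiagonal_durfee {a q : ℂ} (hq : ‖q‖ < 1) (ha : a ≠ 0) (N : ℕ) :
    ∑ p ∈ Finset.HasAntidiagonal.antidiagonal N,
        a ^ p.1 * (q ^ ((p.1 + 1).choose 2) / qPochN q q p.1 *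
          (q ^ ((p.1 + p.2) * p.2) / qPochN q q p.2 * (1 / qPochN q q (p.1 + p.2)))) =
      a ^ N * q ^ (N * (N + 1) / 2) * qPochN (-(1 / a)) q N /
        (qPochN q q N * qPochN q q N) := by
  have hpoch : a ^ N * qPochN (-(1 / a)) q N = ∏ i ∈ Finset.range N, (a + q ^ i) := by
    have hconst : a ^ N = ∏ _i ∈ Finset.range N, a := by
      rw [Finset.prod_const, Finset.card_range]
    rw [qPochN, hconst, ← Finset.prod_mul_distrib]
    refine Finset.prod_congr rfl fun i _ => ?_
    field_simp
    ring
  have hchoose : N * (N + 1) / 2 = (N + 1).choose 2 := by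
    rw [Nat.choose_two_right, Nat.add_sub_cancel, mul_comm]
  have hexp : ∀ m k : ℕ, (m + 1).choose 2 + (m + k) * k =
      (m + k + 1).choose 2 + k.choose 2 := by
    intro m k
    induction k with
    | zero => simp
    | succ k ih =>
      rw [← add_assoc m k 1, Nat.choose_succ_succ' (m + k + 1) 1, Nat.choose_succ_succ' k 1,
        Nat.choose_one_right, Nat.choose_one_right]
      linarith
  calc _ = q ^ (N * (N + 1) / 2) / qPochN q q N *
        ∑ p ∈ Finset.HasAntidiagonal.antidiagonal N,
          a ^ p.1 * q ^ (p.2.choose 2) / (qPochN q q p.1 * qPochN q q p.2) := by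
        rw [Finset.mul_sum]
        refine Finset.sum_congr rfl fun p hp => ?_
        have hpow := congrArg (q ^ ·) (hexp p.1 p.2)
        simp only [pow_add q ((p.1 + 1).choose 2), pow_add q ((p.1 + p.2 + 1).choose 2)] at hpow
        rw [hchoose, ← Finset.HasAntidiagonal.mem_antidiagonal.mp hp]
        calc _ = a ^ p.1 * (q ^ ((p.1 + 1).choose 2) * q ^ ((p.1 + p.2) * p.2)) /
              (qPochN q q p.1 * qPochN q q p.2 * qPochN q q (p.1 + p.2)) := by ring
          _ = _ := by rw [hpow]; ring
    _ = _ := by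
        rw [sum_antidiagonal_qBinomial hq, ← hpoch, div_mul_div_comm]
        ring

end Overpartitions

/-- The generating function for overpartitions with generalized Durfee square of size
`N` (exponent of `q` = weight, exponent of `a` = number of overlined parts) is
`a^N q^{N(N+1)/2} (-1/a;q)_N / ((q;q)_N (q;q)_N)`. -/
theorem gen_fun_durfee (N : ℕ) (a q : ℂ) (hq0 : 0 < ‖q‖) (hq1 : ‖q‖ < 1) (ha : a ≠ 0) :
    ∑' p : ℕ × ℕ,
        (Nat.card {l : List (ℕ × Bool) //
            IsOverpartition l ∧ opWeight l = p.1 ∧ opOverlined l = p.2 ∧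
              genDurfeeSize l = N} : ℂ) * q ^ p.1 * a ^ p.2 =
      a ^ N * q ^ (N * (N + 1) / 2) * qPochN (-(1 / a)) q N /
        (qPochN q q N * qPochN q q N) := by
  have h := hasSum_natCard_fiber
    (g := fun l : {l : List (ℕ × Bool) | IsOverpartition l ∧ genDurfeeSize l = N} =>
      (opWeight (l : List (ℕ × Bool)), opOverlined (l : List (ℕ × Bool))))
    (w := fun p => q ^ p.1 * a ^ p.2) (hasSum_genDurfeeSize_eq hq1 a N)
  rw [sum_antidiagonal_durfee hq1 ha] at h
  rw [← h.tsum_eq]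
  refine tsum_congr fun p => ?_
  rw [mul_assoc]
  congr 2
  refine Nat.card_congr ((Equiv.subtypeEquivRight fun l => ?_).trans
    (Equiv.subtypeSubtypeEquivSubtypeInter
      (fun l => l ∈ {l : List (ℕ × Bool) | IsOverpartition l ∧ genDurfeeSize l = N})
      fun l => (opWeight l, opOverlined l) = p).symm)
  simp only [Prod.ext_iff, Set.mem_ofPred_eq]
  tauto

end Paper
end
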